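/- arXiv:1909.05986 — 2 statements merged into one kernel-verified Lean document; each statement's English description precedes it below -/
import Mathlib

section
/- Suppose every utility function u_i is continuous, semi-strictly quasi-concave, and strictly increasing. Then for every α ∈ (0,1] there exists an α-slack equilibrium (x*, p*) such that x* is 𝒞-constrained Pareto efficient. -/
open Finset

noncomputable def dotO {O : Type*} [Fintype O] (p z : O → ℝ) : ℝ := ∑ l, p l * z l

noncomputable def dotIO {I O : Type*} [Fintype I] [Fintype O] (a x : I → O → ℝ) : ℝ :=
  ∑ i, ∑ l, a i l * x i l

noncomputable def pers {I O C : Type*} [Fintype C] (a : C → I → O → ℝ) (p : C → ℝ)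
    (i : I) : O → ℝ :=
  fun l => ∑ c, a c i l * p c

section Scarf

variable {I T L : Type*} [LinearOrder L]

/-- No point of `T` strictly beats all of `σ` in each of the orders indexed by `K`. -/
def Dominant (r : I → T → L) (σ : Finset T) (K : Finset I) : Prop :=
  ∀ y, ∃ i ∈ K, ∀ x ∈ σ, r i y ≤ r i x

lemma Dominant.mono {r : I → T → L} {σ τ : Finset T} {K D : Finset I} (h : Dominant r σ K)
    (hτ : τ ⊆ σ) (hD : K ⊆ D) : Dominant r τ D := fun y =>
  let ⟨i, hi, hx⟩ := h y
  ⟨i, hD hi, fun x hxτ => hx x (hτ hxτ)⟩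

lemma room_above_door_cases [DecidableEq I] [DecidableEq T] {σ τ : Finset T} {K D : Finset I}
    (hτσ : τ ⊆ σ) (hKD : K ⊆ D) (hD : #D = #τ + 1) (hσ : #σ = #K) :
    (σ = τ ∧ ∃ k ∈ D, K = D.erase k) ∨ (K = D ∧ ∃ x ∉ τ, σ = insert x τ) := by
  have h1 := card_le_card hτσ
  have h2 := card_le_card hKD
  rcases Nat.lt_or_ge #τ #σ with h | h
  · right
    have hK : K = D := eq_of_subset_of_card_le hKD (by omega)
    refine ⟨hK, ?_⟩
    subst hK
    obtain ⟨x, hx, rfl⟩ := (covBy_iff_exists_insert (s := τ) (t := σ)).1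
      (covBy_iff_card_sdiff_eq_one.2 ⟨hτσ, by rw [card_sdiff_of_subset hτσ]; omega⟩)
    exact ⟨x, hx, rfl⟩
  · left
    have hs : τ = σ := eq_of_subset_of_card_le hτσ h
    subst hs
    refine ⟨rfl, ?_⟩
    obtain ⟨x, hx, rfl⟩ := (covBy_iff_exists_insert (s := K) (t := D)).1
      (covBy_iff_card_sdiff_eq_one.2 ⟨hKD, by rw [card_sdiff_of_subset hKD]; omega⟩)
    exact ⟨x, mem_insert_self _ _, by rw [erase_insert hx]⟩

/-- A door with nonempty vertex set lies in exactly two rooms. -/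
lemma card_rooms_above_door [Fintype I] [Fintype T] [DecidableEq I] [DecidableEq T]
    (r : I → T → L) (hr : ∀ i, Function.Injective (r i)) {τ : Finset T} {D : Finset I}
    (hτ : τ.Nonempty) (hdom : Dominant r τ D) (hcard : #D = #τ + 1)
    (s : Finset (Finset T × Finset I))
    (hs : ∀ R, R ∈ s ↔ (Dominant r R.1 R.2 ∧ #R.1 = #R.2) ∧ τ ⊆ R.1 ∧ R.2 ⊆ D) :
    #s = 2 := by
  have hmin : ∀ i, ∃ x ∈ τ, ∀ y ∈ τ, r i x ≤ r i y := fun i => exists_min_image τ (r i) hτ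
  choose μ hμτ hμ using hmin
  have hμeq : ∀ {i y}, y ∈ τ → (∀ x ∈ τ, r i y ≤ r i x) → μ i = y := fun {i y} hy h =>
    hr i (le_antisymm (hμ i y hy) (h _ (hμτ i)))
  have himg : D.image μ = τ := by
    apply subset_antisymm
    · intro x hx
      obtain ⟨i, -, rfl⟩ := mem_image.1 hx
      exact hμτ i
    · intro y hy
      obtain ⟨i, hi, h⟩ := hdom y
      exact mem_image.2 ⟨i, hi, hμeq hy h⟩
  obtain ⟨a, ha, b, hb, hab, hμab⟩ : ∃ a ∈ D, ∃ b ∈ D, a ≠ b ∧ μ a = μ b :=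
    exists_ne_map_eq_of_card_lt_of_maps_to (by omega) (fun i _ => hμτ i)
  have hinj : ∀ k ∈ D, (∀ y ∈ τ, ∃ l ∈ D.erase k, μ l = y) →
      Set.InjOn μ (D.erase k : Finset I) := by
    intro k hk hsurj
    apply injOn_of_card_image_eq
    have : (D.erase k).image μ = τ := by
      apply subset_antisymm
      · intro x hx
        obtain ⟨i, -, rfl⟩ := mem_image.1 hx
        exact hμτ i
      · intro y hy
        obtain ⟨l, hl, h⟩ := hsurj y hy
        exact mem_image.2 ⟨l, hl, h⟩
    rw [this, card_erase_of_mem hk]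
    omega
  have hkab : ∀ k ∈ D, (∀ y ∈ τ, ∃ l ∈ D.erase k, μ l = y) → k = a ∨ k = b := by
    intro k hk hsurj
    by_contra! hne
    exact hab (hinj k hk hsurj (by simp [ha, hne.1.symm]) (by simp [hb, hne.2.symm]) hμab)
  have hsurj : ∀ k, (k = a ∨ k = b) → ∀ y ∈ τ, ∃ l ∈ D.erase k, μ l = y := by
    intro k hk y hy
    rw [← himg] at hy
    obtain ⟨l, hl, rfl⟩ := mem_image.1 hy
    by_cases hlk : l = k
    · subst hlk
      rcases hk with rfl | rfl
      · exact ⟨b, by simp [hb, hab.symm], hμab.symm⟩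
      · exact ⟨a, by simp [ha, hab], hμab⟩
    · exact ⟨l, by simp [hl, hlk], rfl⟩
  let M : I → Finset T := fun k => univ.filter fun x => ∀ l ∈ D.erase k, r l (μ l) < r l x
  have hM : ∀ k x, x ∈ M k ↔ ∀ l ∈ D.erase k, r l (μ l) < r l x := fun k x => by simp [M]
  let V : I → Finset T × Finset I → Prop := fun k R =>
    (R = (τ, D.erase k) ∧ M k = ∅) ∨
      ∃ x ∈ M k, (∀ y ∈ M k, r k y ≤ r k x) ∧ R = (insert x τ, D)
  have hMlt : ∀ k x, x ∈ M k → r k x ≤ r k (μ k) := by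
    intro k x hx
    obtain ⟨l, hl, h⟩ := hdom x
    by_cases hlk : l = k
    · subst hlk; exact h _ (hμτ l)
    · exact absurd (h _ (hμτ l)) (not_le.2 ((hM k x).1 hx l (by simp [hl, hlk])))
  have hMτ : ∀ k, (k = a ∨ k = b) → ∀ x ∈ M k, x ∉ τ := by
    intro k hk x hx hxτ
    obtain ⟨l, hl, rfl⟩ := hsurj k hk x hxτ
    exact lt_irrefl _ ((hM k _).1 hx l hl)
  have hmem : ∀ k, (k = a ∨ k = b) → ∀ R, V k R → R ∈ s := by
    intro k hk R hR
    have hkD : k ∈ D := by rcases hk with rfl | rfl <;> assumption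
    rw [hs]
    rcases hR with ⟨rfl, h0⟩ | ⟨x, hx, hmax, rfl⟩
    · refine ⟨⟨fun y => ?_, by simp only [card_erase_of_mem hkD]; omega⟩, subset_rfl,
        erase_subset _ _⟩
      have hy : y ∉ M k := by simp [h0]
      rw [hM] at hy
      push Not at hy
      obtain ⟨l, hl, hle⟩ := hy
      exact ⟨l, hl, fun x hx => hle.trans (hμ l x hx)⟩
    · refine ⟨⟨fun y => ?_, by simp only [card_insert_of_notMem (hMτ k hk x hx)]; omega⟩,
        subset_insert _ _, subset_rfl⟩
      by_cases hy : y ∈ M k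
      · refine ⟨k, hkD, fun z hz => ?_⟩
        rcases mem_insert.1 hz with rfl | hz
        · exact hmax y hy
        · exact (hMlt k y hy).trans (hμ k z hz)
      · rw [hM] at hy
        push Not at hy
        obtain ⟨l, hl, hle⟩ := hy
        refine ⟨l, mem_of_mem_erase hl, fun z hz => ?_⟩
        rcases mem_insert.1 hz with rfl | hz
        · exact hle.trans ((hM k z).1 hx l hl).le
        · exact hle.trans (hμ l z hz)
  have hex : ∀ k, ∃ R, V k R := by
    intro k
    rcases (M k).eq_empty_or_nonempty with h | h
    · exact ⟨_, Or.inl ⟨rfl, h⟩⟩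
    · obtain ⟨x, hx, hmax⟩ := exists_max_image (M k) (r k) h
      exact ⟨_, Or.inr ⟨x, hx, hmax, rfl⟩⟩
  have huniq : ∀ k R R', V k R → V k R' → R = R' := by
    rintro k R R' (⟨rfl, h⟩ | ⟨x, hx, hmax, rfl⟩) (⟨rfl, h'⟩ | ⟨x', hx', hmax', rfl⟩)
    · rfl
    · simp [h] at hx'
    · simp [h'] at hx
    · rw [hr k (le_antisymm (hmax' x hx) (hmax x' hx'))]
  have hrooms : ∀ R ∈ s, V a R ∨ V b R := by
    rintro ⟨σ, K⟩ hR
    obtain ⟨⟨hd, hc⟩, h1, h2⟩ := (hs _).1 hR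
    suffices ∃ k, (k = a ∨ k = b) ∧ V k (σ, K) by
      obtain ⟨k, rfl | rfl, hk⟩ := this
      · exact Or.inl hk
      · exact Or.inr hk
    rcases room_above_door_cases h1 h2 hcard hc with ⟨h, k, hk, h'⟩ | ⟨h, x, hx, h'⟩
    · dsimp only at h h' hd
      subst h h'
      refine ⟨k, hkab k hk fun y hy => ?_, Or.inl ⟨rfl, ?_⟩⟩
      · obtain ⟨l, hl, h⟩ := hd y
        exact ⟨l, hl, hμeq hy h⟩
      · rw [eq_empty_iff_forall_notMem]
        intro y hy
        obtain ⟨l, hl, h⟩ := hd y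
        exact absurd (h _ (hμτ l)) (not_le.2 ((hM k y).1 hy l hl))
    · dsimp only at h h' hd
      subst h h'
      obtain ⟨k, hk, hxk⟩ := hd x
      have hxlt : r k x < r k (μ k) :=
        lt_of_le_of_ne (hxk _ (mem_insert_of_mem (hμτ k)))
          fun he => hx (hr k he ▸ hμτ k)
      have hsu : ∀ y ∈ τ, ∃ l ∈ K.erase k, μ l = y ∧ r l y ≤ r l x := by
        intro y hy
        obtain ⟨l, hl, h⟩ := hd y
        have hly := hμeq hy fun z hz => h z (mem_insert_of_mem hz)
        have hle := h x (mem_insert_self _ _)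
        refine ⟨l, mem_erase.2 ⟨?_, hl⟩, hly, hle⟩
        rintro rfl
        rw [← hly] at hle
        exact absurd hle (not_le.2 hxlt)
      have hsu' : ∀ y ∈ τ, ∃ l ∈ K.erase k, μ l = y := fun y hy =>
        let ⟨l, hl, h, _⟩ := hsu y hy
        ⟨l, hl, h⟩
      have hxM : x ∈ M k := by
        rw [hM]
        intro l hl
        obtain ⟨l', hl', h1, h2⟩ := hsu _ (hμτ l)
        obtain rfl := hinj k hk hsu' hl' hl h1
        exact lt_of_le_of_ne h2 fun he => hx (hr _ he ▸ hμτ _)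
      refine ⟨k, hkab k hk hsu', Or.inr ⟨x, hxM, fun y hy => ?_, rfl⟩⟩
      obtain ⟨l, hl, h⟩ := hd y
      by_cases hlk : l = k
      · subst hlk; exact h x (mem_insert_self _ _)
      · exact absurd (h _ (mem_insert_of_mem (hμτ l)))
          (not_le.2 ((hM k y).1 hy l (mem_erase.2 ⟨hlk, hl⟩)))
  have hdisj : ∀ R, V a R → ¬ V b R := by
    rintro R (⟨rfl, h⟩ | ⟨x, hx, hmax, rfl⟩) (⟨h1, h'⟩ | ⟨x', hx', hmax', h1⟩)
    · have h2 : D.erase a = D.erase b := (Prod.mk.inj h1).2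
      have : b ∈ D.erase a := by simp [hb, hab.symm]
      simp [h2] at this
    · have h2 : D.erase a = D := (Prod.mk.inj h1).2
      rw [← h2] at ha
      simp at ha
    · have h2 : D = D.erase b := (Prod.mk.inj h1).2
      rw [h2] at hb
      simp at hb
    · have h2 : insert x τ = insert x' τ := (Prod.mk.inj h1).1
      have hxx : x = x' := by
        have : x ∈ insert x' τ := h2 ▸ mem_insert_self x τ
        exact (mem_insert.1 this).resolve_right (hMτ a (Or.inl rfl) x hx)
      subst hxx
      exact absurd ((hM b x).1 hx' a (by simp [ha, hab])) (not_lt.2 (hMlt a x hx))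
  obtain ⟨A, hA⟩ := hex a
  obtain ⟨B, hB⟩ := hex b
  refine card_eq_two.2 ⟨A, B, fun h => hdisj A hA (h ▸ hB), ?_⟩
  ext R
  rw [mem_insert, mem_singleton]
  constructor
  · intro hR
    rcases hrooms R hR with h | h
    · exact Or.inl (huniq a _ _ h hA)
    · exact Or.inr (huniq b _ _ h hB)
  · rintro (rfl | rfl)
    · exact hmem a (Or.inl rfl) _ hA
    · exact hmem b (Or.inr rfl) _ hB


/-- A room whose vertices do not carry exactly its own colors contains an even number of doors
whose vertices carry all colors of the door except `i₀`. -/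
lemma even_card_doors_below_room [Fintype I] [Fintype T] [DecidableEq I] [DecidableEq T]
    (c : T → I) (i₀ : I) {σ : Finset T} {K : Finset I} (hcard : #σ = #K) (hcol : σ.image c ≠ K)
    (s : Finset (Finset T × Finset I))
    (hs : ∀ d, d ∈ s ↔ (#d.2 = #d.1 + 1 ∧ i₀ ∈ d.2 ∧ d.1.image c = d.2.erase i₀) ∧
      d.1 ⊆ σ ∧ K ⊆ d.2) : Even #s := by
  rcases s.eq_empty_or_nonempty with rfl | ⟨⟨τ, D⟩, hd⟩
  · simp
  have key : ∃ x ∈ σ, (σ.erase x, K) ∈ s := by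
    obtain ⟨⟨h1, h2, h3⟩, h4, h5⟩ := (hs _).1 hd
    rcases room_above_door_cases h4 h5 h1 hcard with ⟨h, k, hk, h'⟩ | ⟨h, x, hx, h'⟩
    · dsimp only at h h' h1 h2 h3 h4 h5 hk
      subst h h'
      have hk0 : k ≠ i₀ := by
        rintro rfl
        exact hcol h3
      have : k ∈ σ.image c := by rw [h3]; exact mem_erase.2 ⟨hk0, hk⟩
      obtain ⟨x, hx, rfl⟩ := mem_image.1 this
      have hinj : Set.InjOn c (σ : Set T) := by
        apply injOn_of_card_image_eq
        rw [h3, card_erase_of_mem h2]; omega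
      refine ⟨x, hx, (hs _).2 ⟨⟨?_, mem_erase.2 ⟨hk0.symm, h2⟩, ?_⟩, erase_subset _ _,
        subset_rfl⟩⟩
      · have := card_pos.2 ⟨x, hx⟩
        simp only [card_erase_of_mem hk, card_erase_of_mem hx]; omega
      · dsimp only
        rw [erase_right_comm, ← h3]
        ext k
        simp only [mem_image, mem_erase]
        constructor
        · rintro ⟨z, ⟨hz, hzσ⟩, rfl⟩
          exact ⟨fun he => hz (hinj hzσ hx he), z, hzσ, rfl⟩
        · rintro ⟨hk, z, hz, rfl⟩
          exact ⟨z, ⟨fun he => hk (he ▸ rfl), hz⟩, rfl⟩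
    · dsimp only at h h' h1 h2 h3 h4 h5 hx
      subst h h'
      exact ⟨x, mem_insert_self _ _, by rwa [erase_insert hx]⟩
  clear hd
  obtain ⟨x, hx, hd⟩ := key
  obtain ⟨⟨h1, h2, h3⟩, -, -⟩ := (hs _).1 hd
  dsimp only at h1 h2 h3
  have hinj : Set.InjOn c (σ.erase x : Finset T) := by
    apply injOn_of_card_image_eq
    rw [h3, card_erase_of_mem h2]; omega
  have hσ : σ.image c = insert (c x) (K.erase i₀) := by
    rw [← h3, ← image_insert, insert_erase hx]
  have hx0 : c x ≠ i₀ := by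
    intro h
    rw [h, insert_erase h2] at hσ
    exact hcol hσ
  suffices #s = 2 by rw [this]; exact even_two
  by_cases hxK : c x ∈ K
  · have : c x ∈ (σ.erase x).image c := by rw [h3]; exact mem_erase.2 ⟨hx0, hxK⟩
    obtain ⟨x', hx', hcx⟩ := mem_image.1 this
    have hx'σ := mem_of_mem_erase hx'
    have hne := ne_of_mem_erase hx'
    have hσ' : σ.image c = K.erase i₀ := by
      rw [hσ, insert_eq_of_mem (mem_erase.2 ⟨hx0, hxK⟩)]
    refine card_eq_two.2 ⟨(σ.erase x, K), (σ.erase x', K), ?_, ?_⟩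
    · intro h
      have h' : σ.erase x = σ.erase x' := (Prod.mk.inj h).1
      rw [h'] at hx'
      simp at hx'
    · ext ⟨τ, D⟩
      rw [mem_insert, mem_singleton]
      constructor
      · intro h
        obtain ⟨⟨g1, g2, g3⟩, g4, g5⟩ := (hs _).1 h
        rcases room_above_door_cases g4 g5 g1 hcard with ⟨h, k, hk, h'⟩ | ⟨h, z, hz, h'⟩
        · dsimp only at h h' g1 g2 g3 g4 g5 hk
          subst h
          rw [hσ'] at g3
          have := congrArg card g3
          rw [card_erase_of_mem h2, card_erase_of_mem g2] at this
          have := card_pos.2 ⟨_, hxK⟩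
          omega
        · dsimp only at h h' g1 g2 g3 g4 g5 hz
          subst h h'
          have hcz : c z ∈ K.erase i₀ := hσ' ▸ mem_image_of_mem c (mem_insert_self z τ)
          rw [← g3] at hcz
          obtain ⟨z', hz', hzz⟩ := mem_image.1 hcz
          have hnz : z' ≠ z := by rintro rfl; exact hz hz'
          by_cases hzx : z = x
          · left; rw [hzx, erase_insert (hzx ▸ hz)]
          · right
            by_cases hz'x : z' = x
            · have : z = x' := hinj (by simp [hzx]) (by simp only [coe_erase, Set.mem_sdiff, Set.mem_singleton_iff]; exact ⟨hx'σ, hne⟩)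
                (by rw [hcx, ← hz'x, hzz])
              rw [← this, erase_insert hz]
            · exact absurd (hinj (by simp [hz'x, hz']) (by simp [hzx]) hzz) hnz
      · rintro (h | h)
        · rw [h]; exact hd
        · rw [h, hs]
          refine ⟨⟨?_, h2, ?_⟩, erase_subset _ _, subset_rfl⟩
          · simp only [card_erase_of_mem hx'σ]
            rwa [card_erase_of_mem hx] at h1
          · dsimp only
            rw [← hσ']
            apply subset_antisymm (image_subset_image (erase_subset _ _))
            intro k hk
            obtain ⟨z, hz, rfl⟩ := mem_image.1 hk
            by_cases hzx : z = x'
            · subst hzx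
              exact mem_image.2 ⟨x, mem_erase.2 ⟨hne.symm, hx⟩, hcx.symm⟩
            · exact mem_image_of_mem c (mem_erase.2 ⟨hzx, hz⟩)
  · refine card_eq_two.2 ⟨(σ.erase x, K), (σ, insert (c x) K), ?_, ?_⟩
    · intro h
      have h' : σ.erase x = σ := (Prod.mk.inj h).1
      rw [← h'] at hx
      simp at hx
    · ext ⟨τ, D⟩
      rw [mem_insert, mem_singleton]
      constructor
      · intro h
        obtain ⟨⟨g1, g2, g3⟩, g4, g5⟩ := (hs _).1 h
        rcases room_above_door_cases g4 g5 g1 hcard with ⟨h, k, hk, h'⟩ | ⟨h, z, hz, h'⟩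
        · right
          dsimp only at h h' g1 g2 g3 g4 g5 hk
          rw [← h, ← insert_erase g2, ← g3, ← h, hσ, Finset.insert_comm, insert_erase h2]
        · left
          dsimp only at h h' g1 g2 g3 g4 g5 hz
          subst h h'
          by_cases hzx : z = x
          · rw [hzx, erase_insert (hzx ▸ hz)]
          · have hxτ : x ∈ τ := (mem_insert.1 hx).resolve_left (Ne.symm hzx)
            have := mem_image_of_mem c hxτ
            rw [g3] at this
            exact absurd (mem_of_mem_erase this) hxK
      · rintro (h | h)
        · rw [h]; exact hd
        · rw [h, hs]
          refine ⟨⟨?_, mem_insert_of_mem h2, ?_⟩, subset_rfl, subset_insert _ _⟩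
          · simp only [card_insert_of_notMem hxK]; omega
          · dsimp only
            rw [hσ, erase_insert_of_ne hx0]

/-- **Scarf's lemma**, for colorings: for every coloring of a finite set carrying a family of
linear orders there is a dominant pair formed by a set and its set of colors. -/
theorem exists_dominant_image [Fintype I] [Fintype T] [DecidableEq I] [DecidableEq T]
    [Nonempty I] [Nonempty T] (r : I → T → L) (hr : ∀ i, Function.Injective (r i))
    (c : T → I) : ∃ σ : Finset T, Dominant r σ (σ.image c) := by
  classical
  by_contra! hno
  obtain ⟨i₀⟩ := ‹Nonempty I›
  let doors : Finset (Finset T × Finset I) := univ.filter fun d =>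
    Dominant r d.1 d.2 ∧ #d.2 = #d.1 + 1 ∧ i₀ ∈ d.2 ∧ d.1.image c = d.2.erase i₀
  let rooms : Finset (Finset T × Finset I) := univ.filter fun R =>
    Dominant r R.1 R.2 ∧ #R.1 = #R.2
  let rel : Finset T × Finset I → Finset T × Finset I → Prop := fun d R => d.1 ⊆ R.1 ∧ R.2 ⊆ d.2
  have hcount := sum_card_bipartiteAbove_eq_sum_card_bipartiteBelow rel (s := doors) (t := rooms)
  have heven : Even (∑ R ∈ rooms, #(bipartiteBelow rel doors R)) := by
    refine even_sum _ fun R hR => ?_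
    simp only [rooms, mem_filter, mem_univ, true_and] at hR
    refine even_card_doors_below_room c i₀ hR.2 (fun h => hno R.1 (h ▸ hR.1)) _ fun d => ?_
    simp only [bipartiteBelow, doors, mem_filter, mem_univ, true_and, rel]
    exact ⟨fun h => ⟨h.1.2, h.2⟩, fun h => ⟨⟨hR.1.mono h.2.1 h.2.2, h.1⟩, h.2⟩⟩
  have hd₀ : ((∅, {i₀}) : Finset T × Finset I) ∈ doors := by
    exact mem_filter.2 ⟨mem_univ _, fun y => ⟨i₀, by simp, by simp⟩, by simp, by simp, by simp⟩
  have hone : #(bipartiteAbove rel rooms (∅, {i₀})) = 1 := by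
    obtain ⟨x, -, hx⟩ := exists_max_image (univ : Finset T) (r i₀) univ_nonempty
    refine card_eq_one.2 ⟨({x}, {i₀}), ?_⟩
    ext ⟨σ, K⟩
    simp only [bipartiteAbove, rooms, mem_filter, mem_univ, true_and, rel, mem_singleton,
      Prod.mk.injEq, empty_subset]
    constructor
    · rintro ⟨⟨hd, hc⟩, hK⟩
      obtain ⟨k, hk, h⟩ := hd x
      have hK' : K = {i₀} := (subset_singleton_iff.1 hK).resolve_left (ne_empty_of_mem hk)
      subst hK'
      rw [mem_singleton] at hk
      subst hk
      refine ⟨?_, rfl⟩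
      obtain ⟨z, rfl⟩ := card_eq_one.1 (hc.trans (card_singleton _))
      rw [hr _ (le_antisymm (h z (mem_singleton_self _)) (hx z (mem_univ _)))]
    · rintro ⟨rfl, rfl⟩
      refine ⟨⟨fun y => ⟨i₀, mem_singleton_self _, fun z hz => ?_⟩, by simp⟩, subset_rfl⟩
      rw [mem_singleton.1 hz]
      exact hx y (mem_univ _)
  have htwo : Even (∑ d ∈ doors.erase (∅, {i₀}), #(bipartiteAbove rel rooms d)) := by
    refine even_sum _ fun d hd => ?_
    obtain ⟨hne, hd⟩ := mem_erase.1 hd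
    simp only [doors, mem_filter, mem_univ, true_and] at hd
    obtain ⟨hdom, hcard, hi, himg⟩ := hd
    have hτ : d.1.Nonempty := by
      rw [nonempty_iff_ne_empty]
      intro h
      apply hne
      rw [h, image_empty] at himg
      refine Prod.ext h ?_
      change d.2 = {i₀}
      rw [← insert_erase hi, ← himg]
      rfl
    rw [card_rooms_above_door r hr hτ hdom hcard _ fun R => by
      simp only [bipartiteAbove, rooms, mem_filter, mem_univ, true_and, rel]]
    exact even_two
  rw [← add_sum_erase _ _ hd₀, hone] at hcount
  rw [← hcount, Nat.even_add] at heven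
  exact absurd (heven.2 htwo) (by decide)

end Scarf

section Brouwer

open Filter Topology

variable {ι : Type*} [Fintype ι]

/-- For every coloring of the grid `{v : ι → ℕ | ∑ i, v i = n}` there is a grid point `v` such that
each `i` is the color of a grid point near `v`, unless `v i` is small. -/
lemma exists_grid_point [DecidableEq ι] [Nonempty ι] (n : ℕ)
    (c : {v : ι → ℕ // v ∈ piAntidiag univ n} → ι) :
    ∃ v : {v : ι → ℕ // v ∈ piAntidiag univ n}, ∀ i,
      (∃ w, c w = i ∧ ∀ j, v.1 j ≤ w.1 j + Fintype.card ι ∧ w.1 j ≤ v.1 j + Fintype.card ι) ∨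
        v.1 i ≤ Fintype.card ι := by
  let T := {v : ι → ℕ // v ∈ piAntidiag (univ : Finset ι) n}
  have hT : ∀ v : T, ∑ i, v.1 i = n := fun v => (mem_piAntidiag.1 v.2).1
  have hmk : ∀ v : ι → ℕ, ∑ i, v i = n → v ∈ piAntidiag (univ : Finset ι) n := fun v hv =>
    mem_piAntidiag.2 ⟨hv, fun i _ => mem_univ i⟩
  have : Nonempty T := by
    obtain ⟨i⟩ := ‹Nonempty ι›
    exact ⟨⟨Pi.single i n, hmk _ (by simp)⟩⟩
  let e := Fintype.equivFin T
  let r : ι → T → ℕ ×ₗ Fin (Fintype.card T) := fun i v => toLex (v.1 i, e v)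
  have hr : ∀ i, Function.Injective (r i) := fun i v w h =>
    e.injective (Prod.mk.inj (toLex.injective h)).2
  have hrle : ∀ i v w, r i v ≤ r i w → v.1 i ≤ w.1 i := by
    intro i v w h
    rcases Prod.Lex.toLex_le_toLex.1 h with h | h
    · exact h.le
    · exact h.1.le
  obtain ⟨σ, hσ⟩ := exists_dominant_image r hr c
  set K := σ.image c
  have hKne : K.Nonempty := by
    obtain ⟨i, hi, -⟩ := hσ (Classical.arbitrary T)
    exact ⟨i, hi⟩
  have hσne : σ.Nonempty := image_nonempty.1 hKne
  have hmin : ∀ i, ∃ x ∈ σ, ∀ y ∈ σ, x.1 i ≤ y.1 i := fun i =>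
    exists_min_image σ (fun x => x.1 i) hσne
  choose μ hμσ hμ using hmin
  have hlt : n < ∑ i ∈ K, ((μ i).1 i + 1) := by
    by_contra! hle
    obtain ⟨k, hk⟩ := hKne
    let y : ι → ℕ := fun i => (if i ∈ K then (μ i).1 i + 1 else 0) +
      if i = k then n - ∑ i ∈ K, ((μ i).1 i + 1) else 0
    have hy : ∑ i, y i = n := by
      simp only [y, sum_add_distrib, sum_ite_mem, univ_inter, sum_ite_eq', mem_univ, if_true]
      rw [← sum_add_distrib]
      omega
    obtain ⟨i, hi, h⟩ := hσ ⟨y, hmk y hy⟩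
    have := hrle _ _ _ (h _ (hμσ i))
    simp only [y, hi, if_true] at this
    omega
  have hbound : ∀ v ∈ σ, ∀ i, (i ∈ K → v.1 i ≤ (μ i).1 i + Fintype.card ι) ∧
      (i ∉ K → v.1 i ≤ Fintype.card ι) := by
    intro v hv i
    let d : ι → ℕ := fun i => if i ∈ K then v.1 i - (μ i).1 i else v.1 i
    have hd : ∑ i, d i + ∑ i ∈ K, (μ i).1 i = n := by
      refine Eq.trans ?_ (hT v)
      rw [← univ_inter K, ← sum_ite_mem, ← sum_add_distrib]
      refine sum_congr rfl fun j _ => ?_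
      by_cases hj : j ∈ K
      · simp only [d, hj, if_true]
        exact Nat.sub_add_cancel (hμ j v hv)
      · simp [d, hj]
    rw [sum_add_distrib, sum_const, smul_eq_mul, mul_one] at hlt
    have hc : #K ≤ Fintype.card ι := card_le_univ K
    have hdi : d i ≤ ∑ i, d i := single_le_sum (fun _ _ => Nat.zero_le _) (mem_univ i)
    constructor <;> intro hi <;> simp only [d, hi, if_true, if_false] at hdi hd <;> omega
  obtain ⟨v, hv⟩ := hσne
  refine ⟨v, fun i => ?_⟩
  by_cases hi : i ∈ K
  · left
    obtain ⟨w, hw, rfl⟩ := mem_image.1 hi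
    refine ⟨w, rfl, fun j => ?_⟩
    have h1 := hbound v hv j
    have h2 := hbound w hw j
    have h3 := hμ j v hv
    have h4 := hμ j w hw
    by_cases hj : j ∈ K
    · have := h1.1 hj
      have := h2.1 hj
      omega
    · have := h1.2 hj
      have := h2.2 hj
      omega
  · exact Or.inr ((hbound v hv i).2 hi)

lemma exists_approx_fixedPoint [Nonempty ι] (f : (ι → ℝ) → ι → ℝ)
    (hmaps : Set.MapsTo f (stdSimplex ℝ ι) (stdSimplex ℝ ι)) (n : ℕ) (hn : 0 < n) :
    ∃ x ∈ stdSimplex ℝ ι, ∀ i, ∃ y ∈ stdSimplex ℝ ι, dist y x ≤ Fintype.card ι / n ∧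
      y i ≤ f y i + Fintype.card ι / n := by
  classical
  have hn' : (0 : ℝ) < n := Nat.cast_pos.2 hn
  let pt : {v : ι → ℕ // v ∈ piAntidiag univ n} → ι → ℝ := fun v i => v.1 i / n
  have hpt : ∀ v, pt v ∈ stdSimplex ℝ ι := by
    intro v
    refine ⟨fun i => by positivity, ?_⟩
    rw [← sum_div, ← Nat.cast_sum, (mem_piAntidiag.1 v.2).1, div_self hn'.ne']
  have hcol : ∀ v, ∃ i, pt v i ≤ f (pt v) i := by
    intro v
    obtain ⟨i, -, hi⟩ := exists_le_of_sum_le (s := univ) univ_nonempty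
      ((hpt v).2.trans (hmaps (hpt v)).2.symm).le
    exact ⟨i, hi⟩
  choose c hc using hcol
  obtain ⟨v, hv⟩ := exists_grid_point n c
  refine ⟨pt v, hpt v, fun i => ?_⟩
  rcases hv i with ⟨w, rfl, hw⟩ | hvi
  · refine ⟨pt w, hpt w, (dist_pi_le_iff (by positivity)).2 fun j => ?_, ?_⟩
    · have h1 : (v.1 j : ℝ) ≤ w.1 j + Fintype.card ι := mod_cast (hw j).1
      have h2 : (w.1 j : ℝ) ≤ v.1 j + Fintype.card ι := mod_cast (hw j).2
      rw [Real.dist_eq, ← sub_div, abs_div, abs_of_pos hn']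
      exact div_le_div_of_nonneg_right (abs_le.2 ⟨by linarith, by linarith⟩) hn'.le
    · exact (hc w).trans (le_add_of_nonneg_right (by positivity))
  · refine ⟨pt v, hpt v, by rw [dist_self]; positivity, ?_⟩
    have h1 : pt v i ≤ Fintype.card ι / n :=
      div_le_div_of_nonneg_right (Nat.cast_le.2 hvi) hn'.le
    exact h1.trans (le_add_of_nonneg_left ((hmaps (hpt v)).1 i))

/-- **Brouwer's fixed point theorem** for the standard simplex. -/
theorem exists_fixedPoint_stdSimplex [Nonempty ι] (f : (ι → ℝ) → ι → ℝ)
    (hf : ContinuousOn f (stdSimplex ℝ ι))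
    (hmaps : Set.MapsTo f (stdSimplex ℝ ι) (stdSimplex ℝ ι)) :
    ∃ x ∈ stdSimplex ℝ ι, f x = x := by
  choose x hx y hy hyx hyf using fun n : ℕ =>
    exists_approx_fixedPoint f hmaps (n + 1) n.succ_pos
  obtain ⟨x₀, hx₀, φ, hφ, hlim⟩ := (isCompact_stdSimplex ℝ ι).tendsto_subseq hx
  have hzero : Tendsto (fun n : ℕ => (Fintype.card ι : ℝ) / ((φ n + 1 : ℕ) : ℝ)) atTop (𝓝 0) :=
    (tendsto_const_div_atTop_nhds_zero_nat _).comp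
      ((tendsto_add_atTop_nat 1).comp hφ.tendsto_atTop)
  have hle : ∀ i, x₀ i ≤ f x₀ i := by
    intro i
    have hylim : Tendsto (fun n => y (φ n) i) atTop (𝓝 x₀) := by
      refine hlim.congr_dist ?_
      refine squeeze_zero (fun _ => dist_nonneg) (fun n => ?_) hzero
      rw [dist_comm]
      exact hyx (φ n) i
    have hfy : Tendsto (fun n => f (y (φ n) i)) atTop (𝓝 (f x₀)) :=
      (hf x₀ hx₀).tendsto.comp
        (tendsto_nhdsWithin_iff.2 ⟨hylim, Eventually.of_forall fun n => hy _ _⟩)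
    have h1 := (continuous_apply i).continuousAt.tendsto.comp hylim
    have h2 := ((continuous_apply i).continuousAt.tendsto.comp hfy).add hzero
    rw [add_zero] at h2
    exact le_of_tendsto_of_tendsto' h1 h2 fun n => hyf (φ n) i
  refine ⟨x₀, hx₀, funext fun i => ?_⟩
  exact (((sum_eq_sum_iff_of_le fun i _ => hle i).1
    (hx₀.2.trans (hmaps hx₀).2.symm)) i (mem_univ i)).symm

end Brouwer

section Equilibrium

open Filter Topology Matrix

variable {ι : Type*} [Fintype ι]

/-- A compact convex set of excess demands containing no `z` with `z i ≤ s ⬝ᵥ z` for all `i` is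
strictly improved upon in value by some other point of the simplex. -/
lemma exists_stdSimplex_dotProduct_lt {s : ι → ℝ} (hs : s ∈ stdSimplex ℝ ι) {Z : Set (ι → ℝ)}
    (hcpt : IsCompact Z) (hcvx : Convex ℝ Z) (hZ : ∀ z ∈ Z, ∃ i, s ⬝ᵥ z < z i) :
    ∃ q ∈ stdSimplex ℝ ι, ∀ z ∈ Z, s ⬝ᵥ z < q ⬝ᵥ z := by
  classical
  let N : Set (ι → ℝ) := {z | ∀ i, z i ≤ s ⬝ᵥ z}
  have hNcone : ∀ z ∈ N, ∀ t : ℝ, 0 ≤ t → t • z ∈ N := by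
    intro z hz t ht i
    rw [dotProduct_smul]
    exact mul_le_mul_of_nonneg_left (hz i) ht
  have hNcvx : Convex ℝ N := by
    intro z hz w hw α β hα hβ _ i
    rw [dotProduct_add, dotProduct_smul, dotProduct_smul]
    exact add_le_add (mul_le_mul_of_nonneg_left (hz i) hα)
      (mul_le_mul_of_nonneg_left (hw i) hβ)
  have hcont : Continuous fun z : ι → ℝ => s ⬝ᵥ z := by unfold dotProduct; fun_prop
  have hNcl : IsClosed N := by
    simp only [N, Set.ofPred_forall]
    exact isClosed_iInter fun i => isClosed_le (continuous_apply i) hcont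
  have hdisj : Disjoint Z N := by
    rw [Set.disjoint_left]
    intro z hz hzN
    obtain ⟨i, hi⟩ := hZ z hz
    exact absurd (hzN i) (not_le.2 hi)
  obtain ⟨f, u, v, hfu, huv, hfv⟩ :=
    geometric_hahn_banach_compact_closed hcvx hcpt hNcvx hNcl hdisj
  have h0 : (0 : ι → ℝ) ∈ N := fun i => by simp
  have hv : v < 0 := by simpa using hfv 0 h0
  have hfN : ∀ z ∈ N, 0 ≤ f z := by
    intro z hz
    by_contra! hneg
    have := hfv _ (hNcone z hz (v / f z) (div_pos_of_neg_of_neg hv hneg).le)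
    rw [map_smul, smul_eq_mul, div_mul_cancel₀ _ hneg.ne] at this
    exact lt_irrefl _ this
  let g : ι → ℝ := fun i => -f (Pi.single i 1)
  have hfg : ∀ z, f z = -(g ⬝ᵥ z) := by
    intro z
    conv_lhs => rw [pi_eq_sum_univ' z]
    rw [map_sum, dotProduct, ← sum_neg_distrib]
    refine sum_congr rfl fun i _ => ?_
    rw [map_smul, smul_eq_mul]
    simp only [g]
    ring
  have hg1 : ∑ i, g i = 0 := by
    have e1 : (fun _ => 1 : ι → ℝ) ∈ N := fun i => by simp [dotProduct, hs.2]
    have e2 : (fun _ => -1 : ι → ℝ) ∈ N := fun i => by simp [dotProduct, hs.2]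
    have h1 := hfN _ e1
    have h2 := hfN _ e2
    rw [hfg] at h1 h2
    simp only [dotProduct, mul_one, mul_neg, sum_neg_distrib] at h1 h2
    linarith
  have hg0 : ∀ i, s i = 0 → 0 ≤ g i := by
    intro i hi
    have e : -Pi.single i 1 ∈ N := by
      intro j
      rw [dotProduct_neg, dotProduct_single_one, hi, neg_zero, Pi.neg_apply, neg_nonpos]
      by_cases hj : j = i
      · subst hj; simp
      · simp [hj]
    have := hfN _ e
    rwa [map_neg] at this
  have hev : ∀ᶠ ε : ℝ in 𝓝[>] 0, ∀ i, 0 ≤ s i + ε * g i := by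
    rw [eventually_all]
    intro i
    rcases (hs.1 i).eq_or_lt with h | h
    · filter_upwards [self_mem_nhdsWithin] with ε hε
      rw [← h, zero_add]
      exact mul_nonneg (le_of_lt hε) (hg0 i h.symm)
    · have hc : Tendsto (fun ε : ℝ => s i + ε * g i) (𝓝[>] 0) (𝓝 (s i + 0 * g i)) :=
        (Continuous.tendsto (by fun_prop) 0).mono_left nhdsWithin_le_nhds
      rw [zero_mul, add_zero] at hc
      exact (hc.eventually_const_lt h).mono fun _ h => h.le
  obtain ⟨ε, hε, hε0⟩ := (hev.and self_mem_nhdsWithin).exists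
  refine ⟨s + ε • g, ⟨hε, ?_⟩, fun z hz => ?_⟩
  · simp only [Pi.add_apply, Pi.smul_apply, smul_eq_mul, sum_add_distrib, ← mul_sum, hg1, hs.2,
      mul_zero, add_zero]
  · rw [add_dotProduct, smul_dotProduct, smul_eq_mul]
    have h1 := hfu z hz
    rw [hfg] at h1
    have : 0 < ε * (g ⬝ᵥ z) := mul_pos hε0 (by linarith)
    linarith

/-- **Gale–Nikaido–Debreu lemma**: a correspondence on the simplex with compact graph and nonempty
convex values has a point in its graph whose value no vertex of the simplex improves upon. -/
theorem exists_mem_forall_le_dotProduct [Nonempty ι] (Z : (ι → ℝ) → Set (ι → ℝ))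
    (hne : ∀ s ∈ stdSimplex ℝ ι, (Z s).Nonempty) (hcvx : ∀ s ∈ stdSimplex ℝ ι, Convex ℝ (Z s))
    (hgraph : IsCompact {q : (ι → ℝ) × (ι → ℝ) | q.1 ∈ stdSimplex ℝ ι ∧ q.2 ∈ Z q.1}) :
    ∃ s ∈ stdSimplex ℝ ι, ∃ z ∈ Z s, ∀ i, z i ≤ s ⬝ᵥ z := by
  classical
  by_contra! hno
  have hsep : ∀ s ∈ stdSimplex ℝ ι, ∃ q ∈ stdSimplex ℝ ι, ∀ z ∈ Z s, s ⬝ᵥ z < q ⬝ᵥ z := by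
    intro s hs
    refine exists_stdSimplex_dotProduct_lt hs ?_ (hcvx s hs) (hno s hs)
    have := (hgraph.inter_right
      (isClosed_singleton.preimage continuous_fst : IsClosed (Prod.fst ⁻¹' {s}))).image
        continuous_snd
    convert this using 1
    ext z
    constructor
    · exact fun hz => ⟨(s, z), ⟨⟨hs, hz⟩, rfl⟩, rfl⟩
    · rintro ⟨⟨s', z'⟩, ⟨⟨-, h⟩, rfl⟩, rfl⟩
      exact h
  let t : stdSimplex ℝ ι → Set (ι → ℝ) := fun s =>
    {q | q ∈ stdSimplex ℝ ι ∧ ∀ z ∈ Z s.1, s.1 ⬝ᵥ z < q ⬝ᵥ z}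
  have htcvx : ∀ s, Convex ℝ (t s) := by
    intro s q hq q' hq' α β hα hβ hαβ
    refine ⟨convex_stdSimplex ℝ ι hq.1 hq'.1 hα hβ hαβ, fun z hz => ?_⟩
    rw [add_dotProduct, smul_dotProduct, smul_dotProduct]
    exact convex_Ioi (𝕜 := ℝ) (s.1 ⬝ᵥ z) (hq.2 z hz) (hq'.2 z hz) hα hβ hαβ
  have hloc : ∀ s, ∃ q, ∀ᶠ s' in 𝓝 s, q ∈ t s' := by
    intro s
    obtain ⟨q, hq, hqs⟩ := hsep s.1 s.2
    refine ⟨q, ?_⟩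
    have hcl : IsClosed {y : (ι → ℝ) × (ι → ℝ) | q ⬝ᵥ y.2 ≤ y.1 ⬝ᵥ y.2} := by
      unfold dotProduct
      exact isClosed_le (by fun_prop) (by fun_prop)
    have hcl' := (((hgraph.inter_right hcl).image continuous_fst).isClosed.preimage
      (continuous_subtype_val (p := fun x => x ∈ stdSimplex ℝ ι))).isOpen_compl
    filter_upwards [hcl'.mem_nhds (x := s) (by
      rintro ⟨⟨s', z⟩, ⟨⟨-, hz⟩, hle⟩, hs'⟩
      change s' = s.1 at hs'
      subst hs'
      exact absurd (hqs z hz) (not_lt.2 hle))] with s' hs'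
    refine ⟨hq, fun z hz => ?_⟩
    by_contra! hle
    exact hs' ⟨(s'.1, z), ⟨⟨s'.2, hz⟩, hle⟩, rfl⟩
  obtain ⟨g, hg⟩ := exists_continuous_forall_mem_convex_of_local_const htcvx hloc
  let f : (ι → ℝ) → ι → ℝ := fun x => if h : x ∈ stdSimplex ℝ ι then g ⟨x, h⟩ else 0
  have hfg : ∀ x (hx : x ∈ stdSimplex ℝ ι), f x = g ⟨x, hx⟩ := fun x hx => dif_pos hx
  obtain ⟨x, hx, hfx⟩ := exists_fixedPoint_stdSimplex f
    (continuousOn_iff_continuous_domRestrict.2 (by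
      convert g.continuous using 1
      ext1 x
      exact hfg x.1 x.2))
    (fun x hx => by
      rw [hfg x hx]
      exact (hg _).1)
  obtain ⟨z, hz⟩ := hne x hx
  have := (hg ⟨x, hx⟩).2 z hz
  rw [← hfg x hx, hfx] at this
  exact lt_irrefl _ this

end Equilibrium

section Demand

open Filter Topology

variable {O : Type*} [Fintype O]

lemma dotO_smul (p z : O → ℝ) (t : ℝ) : dotO p (t • z) = t * dotO p z := by
  simp only [dotO, Pi.smul_apply, smul_eq_mul, mul_sum]
  exact sum_congr rfl fun _ _ => by ring

lemma dotO_add (p z w : O → ℝ) : dotO p (z + w) = dotO p z + dotO p w := by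
  simp only [dotO, Pi.add_apply, mul_add, sum_add_distrib]

lemma continuous_dotO_right (p : O → ℝ) : Continuous (dotO p) := by unfold dotO; fun_prop

/-- The bundles of `X` that maximize `u` on the budget set and, if a bliss point is affordable, are
no more expensive than any bliss point. The maximality is stated against bundles that cost strictly
less than the income `w`, which makes the correspondence visibly closed. -/
def cheapestDemand (u : (O → ℝ) → ℝ) (X : Set (O → ℝ)) (p : O → ℝ) (w : ℝ) : Set (O → ℝ) :=
  {z | z ∈ X ∧ dotO p z ≤ w ∧ (∀ y ∈ X, dotO p y < w → u y ≤ u z) ∧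
    ∀ y ∈ X, (∀ y' ∈ X, u y' ≤ u y) → dotO p z ≤ dotO p y}

variable {u : (O → ℝ) → ℝ} {X : Set (O → ℝ)}

lemma cheapestDemand_nonempty (hX : IsCompact X) (hX0 : 0 ∈ X) (hu : ContinuousOn u X)
    (p : O → ℝ) {w : ℝ} (hw : 0 ≤ w) : (cheapestDemand u X p w).Nonempty := by
  have hp := continuous_dotO_right p
  by_cases hb : ∃ y ∈ X, (∀ y' ∈ X, u y' ≤ u y) ∧ dotO p y ≤ w
  · obtain ⟨y, hy, hmax, hyw⟩ := hb
    have hcl : IsClosed (X ∩ u ⁻¹' Set.Ici (u y)) :=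
      hu.preimage_isClosed_of_isClosed hX.isClosed isClosed_Ici
    obtain ⟨z, ⟨hz, hzy⟩, hmin⟩ := (hX.of_isClosed_subset hcl Set.inter_subset_left).exists_isMinOn
      ⟨y, hy, le_refl (u y)⟩ hp.continuousOn
    exact ⟨z, hz, (hmin ⟨hy, le_refl (u y)⟩).trans hyw, fun y' hy' _ => (hmax y' hy').trans hzy,
      fun y' hy' hmax' => hmin ⟨hy', hmax' y hy⟩⟩
  · push Not at hb
    obtain ⟨z, ⟨hz, hzw⟩, hmax⟩ :=
      (hX.inter_right (isClosed_le hp continuous_const : IsClosed {z | dotO p z ≤ w})).exists_isMaxOn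
        ⟨0, hX0, by simpa [dotO] using hw⟩ (hu.mono Set.inter_subset_left)
    exact ⟨z, hz, hzw, fun y hy hyw => hmax ⟨hy, hyw.le⟩,
      fun y hy hy' => hzw.trans (hb y hy hy').le⟩

lemma convex_cheapestDemand (hX : Convex ℝ X)
    (hqc : ∀ z ∈ X, ∀ w ∈ X, ∀ t : ℝ, 0 ≤ t → t ≤ 1 → min (u z) (u w) ≤ u (t • z + (1 - t) • w))
    (p : O → ℝ) (w : ℝ) : Convex ℝ (cheapestDemand u X p w) := by
  rintro z ⟨hz, hzw, hzu, hzb⟩ z' ⟨hz', hzw', hzu', hzb'⟩ s t hs ht hst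
  obtain rfl : t = 1 - s := by linarith
  have hle : ∀ m, dotO p z ≤ m → dotO p z' ≤ m → dotO p (s • z + (1 - s) • z') ≤ m := by
    intro m h h'
    rw [dotO_add, dotO_smul, dotO_smul]
    exact convex_Iic (𝕜 := ℝ) m h h' hs ht hst
  exact ⟨hX hz hz' hs ht hst, hle w hzw hzw',
    fun y hy hyw => (le_min (hzu y hy hyw) (hzu' y hy hyw)).trans
      (hqc z hz z' hz' s hs (by linarith)),
    fun y hy hmax => hle _ (hzb y hy hmax) (hzb' y hy hmax)⟩

lemma isClosed_graph_cheapestDemand (hX : IsClosed X) (hu : ContinuousOn u X) :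
    IsClosed {q : (O → ℝ) × ℝ × (O → ℝ) | q.2.2 ∈ cheapestDemand u X q.1 q.2.1} := by
  have hsnd : Continuous fun q : (O → ℝ) × ℝ × (O → ℝ) => q.2.2 := by fun_prop
  have hdot : Continuous fun q : (O → ℝ) × ℝ × (O → ℝ) => dotO q.1 q.2.2 := by
    unfold dotO; fun_prop
  have hdoty : ∀ y, Continuous fun q : (O → ℝ) × ℝ × (O → ℝ) => dotO q.1 y := by
    unfold dotO; fun_prop
  have hw : Continuous fun q : (O → ℝ) × ℝ × (O → ℝ) => q.2.1 := by fun_prop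
  have heq : {q : (O → ℝ) × ℝ × (O → ℝ) | q.2.2 ∈ cheapestDemand u X q.1 q.2.1} =
      ({q | q.2.2 ∈ X} ∩ {q | dotO q.1 q.2.2 ≤ q.2.1}) ∩
      ((⋂ y ∈ X, ({q | q.2.1 ≤ dotO q.1 y} ∪ (fun q => q.2.2) ⁻¹' (X ∩ u ⁻¹' Set.Ici (u y)))) ∩
        ⋂ y ∈ X, ⋂ (_ : ∀ y' ∈ X, u y' ≤ u y), {q | dotO q.1 q.2.2 ≤ dotO q.1 y}) := by
    ext q
    simp only [cheapestDemand, Set.mem_ofPred_eq, Set.mem_inter_iff, Set.mem_iInter, Set.mem_union,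
      Set.mem_preimage, Set.mem_Ici]
    constructor
    · rintro ⟨h1, h2, h3, h4⟩
      refine ⟨⟨h1, h2⟩, fun y hy => ?_, h4⟩
      rcases le_or_gt q.2.1 (dotO q.1 y) with h | h
      · exact Or.inl h
      · exact Or.inr ⟨h1, h3 y hy h⟩
    · rintro ⟨⟨h1, h2⟩, h3, h4⟩
      exact ⟨h1, h2, fun y hy h => ((h3 y hy).resolve_left (not_le.2 h)).2, h4⟩
  rw [heq]
  refine ((hX.preimage hsnd).inter (isClosed_le hdot hw)).inter
    ((isClosed_biInter fun y _ => (isClosed_le hw (hdoty y)).union ?_).inter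
      (isClosed_biInter fun y _ => isClosed_iInter fun _ => isClosed_le hdot (hdoty y)))
  exact (hu.preimage_isClosed_of_isClosed hX isClosed_Ici).preimage hsnd

lemma le_of_mem_cheapestDemand (hX : Convex ℝ X) (hX0 : 0 ∈ X) (hu : ContinuousOn u X)
    {p z : O → ℝ} {w : ℝ} (hw : 0 < w) (hz : z ∈ cheapestDemand u X p w) {y : O → ℝ} (hy : y ∈ X)
    (hyw : dotO p y ≤ w) : u y ≤ u z := by
  have hmem : ∀ t : ℝ, 0 < t → t < 1 → t • y ∈ X := fun t h0 h1 =>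
    hX.smul_mem_of_zero_mem hX0 hy ⟨h0.le, h1.le⟩
  have hev : ∀ᶠ t : ℝ in 𝓝[<] 1, 0 < t ∧ t < 1 :=
    Ioo_mem_nhdsLT one_pos
  have hlim : Tendsto (fun t : ℝ => t • y) (𝓝[<] 1) (𝓝[X] y) := by
    refine tendsto_nhdsWithin_iff.2 ⟨?_, hev.mono fun t h => hmem t h.1 h.2⟩
    have : Tendsto (fun t : ℝ => t • y) (𝓝 1) (𝓝 ((1 : ℝ) • y)) :=
      Continuous.tendsto (by fun_prop) 1
    rw [one_smul] at this
    exact this.mono_left nhdsWithin_le_nhds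
  refine le_of_tendsto ((hu y hy).tendsto.comp hlim) (hev.mono fun t h => ?_)
  refine hz.2.2.1 _ (hmem t h.1 h.2) ?_
  rw [dotO_smul]
  nlinarith [mul_le_mul_of_nonneg_left hyw h.1.le, mul_lt_mul_of_pos_right h.2 hw]

lemma dotO_le_of_mem_cheapestDemand (hX : Convex ℝ X)
    (hssqc : ∀ z ∈ X, ∀ w ∈ X, ∀ t : ℝ, 0 < t → t < 1 → u z ≠ u w →
      min (u z) (u w) < u (t • z + (1 - t) • w))
    {p z : O → ℝ} {w : ℝ} (hz : z ∈ cheapestDemand u X p w) {y : O → ℝ} (hy : y ∈ X)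
    (hyz : u z ≤ u y) : dotO p z ≤ dotO p y := by
  by_contra! hlt
  obtain ⟨y', hy', hyy'⟩ : ∃ y' ∈ X, u y < u y' := by
    by_contra! hmax
    exact absurd (hz.2.2.2 y hy hmax) (not_le.2 hlt)
  have hlim : Tendsto (fun t : ℝ => dotO p (t • y' + (1 - t) • y)) (𝓝[>] 0) (𝓝 (dotO p y)) := by
    have : Tendsto (fun t : ℝ => dotO p (t • y' + (1 - t) • y)) (𝓝 0)
        (𝓝 (dotO p ((0 : ℝ) • y' + (1 - 0 : ℝ) • y))) :=
      Continuous.tendsto ((continuous_dotO_right p).comp (by fun_prop)) 0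
    rw [zero_smul, zero_add, sub_zero, one_smul] at this
    exact this.mono_left nhdsWithin_le_nhds
  have hev : ∀ᶠ t : ℝ in 𝓝[>] 0, 0 < t ∧ t < 1 := Ioo_mem_nhdsGT one_pos
  obtain ⟨t, ht, ht0, ht1⟩ :=
    ((hlim.eventually_lt_const (hlt.trans_le hz.2.1)).and hev).exists
  have h1 := hssqc y' hy' y hy t ht0 ht1 hyy'.ne'
  rw [min_eq_right hyy'.le] at h1
  have h2 := hz.2.2.1 _ (hX hy' hy ht0.le (by linarith) (by linarith)) ht
  linarith

end Demand

section Prices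

variable {I O C : Type*} [Fintype I] [Fintype O] [Fintype C]

lemma sum_dotO_pers (a : C → I → O → ℝ) (p : C → ℝ) (x : I → O → ℝ) :
    ∑ i, dotO (pers a p i) (x i) = ∑ c, p c * dotIO (a c) x := by
  simp only [dotO, pers, dotIO, mul_sum, sum_mul]
  conv_rhs => rw [sum_comm]
  refine sum_congr rfl fun i _ => ?_
  rw [sum_comm]
  exact sum_congr rfl fun c _ => sum_congr rfl fun l _ => by ring

lemma continuous_dotIO (a : I → O → ℝ) : Continuous (dotIO a) := by unfold dotIO; fun_prop

lemma dotIO_combo (a x y : I → O → ℝ) (s t : ℝ) :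
    dotIO a (s • x + t • y) = s * dotIO a x + t * dotIO a y := by
  simp only [dotIO, Pi.add_apply, Pi.smul_apply, smul_eq_mul, mul_sum, ← sum_add_distrib]
  exact sum_congr rfl fun i _ => sum_congr rfl fun l _ => by ring

/-- The income of agent `i` at prices `p`. -/
noncomputable def income (a : C → I → O → ℝ) (ω : I → O → ℝ) (α : ℝ) (p : C → ℝ) (i : I) : ℝ :=
  α + (1 - α) * dotO (pers a p i) (ω i)

/-- Market clearing: there are prices supporting cheapest demands that satisfy all constraints,
with complementary slackness. -/
theorem exists_clearing_prices (X : I → Set (O → ℝ)) (hXcpt : ∀ i, IsCompact (X i))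
    (hXcvx : ∀ i, Convex ℝ (X i)) (hX0 : ∀ i, (0 : O → ℝ) ∈ X i)
    (a : C → I → O → ℝ) (b : C → ℝ) (ha : ∀ c i l, 0 ≤ a c i l) (hb : ∀ c, 0 < b c)
    (u : I → (O → ℝ) → ℝ) (hu : ∀ i, ContinuousOn (u i) (X i))
    (hqc : ∀ i, ∀ z ∈ X i, ∀ w ∈ X i, ∀ t : ℝ, 0 ≤ t → t ≤ 1 →
      min (u i z) (u i w) ≤ u i (t • z + (1 - t) • w))
    (ω : I → O → ℝ) (hω0 : ∀ i l, 0 ≤ ω i l) (hωb : ∀ c, dotIO (a c) ω ≤ b c)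
    (α : ℝ) (hα0 : 0 < α) (hα1 : α ≤ 1) :
    ∃ (x : I → O → ℝ) (p : C → ℝ), (∀ c, 0 ≤ p c) ∧
      (∀ i, x i ∈ cheapestDemand (u i) (X i) (pers a p i) (income a ω α p i)) ∧
      (∀ c, dotIO (a c) x ≤ b c) ∧ ∀ c, dotIO (a c) x < b c → p c = 0 := by
  classical
  set κ : ℝ := Fintype.card I + 1 with hκ
  have hκ0 : 0 < κ := by positivity
  let price : (Option C → ℝ) → C → ℝ := fun s c => κ * s (some c) / b c
  let ex : (I → O → ℝ) → Option C → ℝ := fun x o =>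
    o.elim 0 fun c => κ / b c * (dotIO (a c) x - b c)
  let dem : (Option C → ℝ) → Set (I → O → ℝ) := fun s =>
    {x | ∀ i, x i ∈ cheapestDemand (u i) (X i) (pers a (price s) i) (income a ω α (price s) i)}
  have hprice0 : ∀ s ∈ stdSimplex ℝ (Option C), ∀ c, 0 ≤ price s c := fun s hs c =>
    div_nonneg (mul_nonneg hκ0.le (hs.1 _)) (hb c).le
  have hinc : ∀ p : C → ℝ, (∀ c, 0 ≤ p c) → ∀ i, 0 ≤ income a ω α p i := fun p hp i => by
    have : 0 ≤ dotO (pers a p i) (ω i) := sum_nonneg fun l _ =>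
      mul_nonneg (sum_nonneg fun c _ => mul_nonneg (ha c i l) (hp c)) (hω0 i l)
    exact add_nonneg hα0.le (mul_nonneg (by linarith) this)
  have hexc : Continuous ex := by
    refine continuous_pi fun o => ?_
    cases o with
    | none => exact continuous_const
    | some c => exact continuous_const.mul ((continuous_dotIO (a c)).sub continuous_const)
  have hgraph : IsCompact {q : (Option C → ℝ) × (I → O → ℝ) |
      q.1 ∈ stdSimplex ℝ (Option C) ∧ q.2 ∈ dem q.1} := by
    refine ((isCompact_stdSimplex ℝ (Option C)).prod
      (isCompact_univ_pi hXcpt)).of_isClosed_subset ?_ fun q hq => ⟨hq.1, fun i _ => (hq.2 i).1⟩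
    have hcl : IsClosed (⋂ i, {q : (Option C → ℝ) × (I → O → ℝ) | q.2 i ∈
        cheapestDemand (u i) (X i) (pers a (price q.1) i) (income a ω α (price q.1) i)}) := by
      refine isClosed_iInter fun i => ?_
      have hc : Continuous fun q : (Option C → ℝ) × (I → O → ℝ) =>
          (pers a (price q.1) i, income a ω α (price q.1) i, q.2 i) := by
        unfold income dotO pers
        fun_prop
      exact (isClosed_graph_cheapestDemand (hXcpt i).isClosed (hu i)).preimage hc
    convert ((isClosed_stdSimplex ℝ (Option C)).preimage continuous_fst).inter hcl using 1
    ext q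
    simp [dem]
  obtain ⟨s, hs, z, ⟨x, hx, rfl⟩, hz⟩ := exists_mem_forall_le_dotProduct (fun s => ex '' dem s)
    (fun s hs => by
      choose x hx using fun i => cheapestDemand_nonempty (hXcpt i) (hX0 i) (hu i)
        (pers a (price s) i) (hinc _ (hprice0 s hs) i)
      exact ⟨_, x, hx, rfl⟩)
    (fun s hs => by
      rintro _ ⟨x, hx, rfl⟩ _ ⟨y, hy, rfl⟩ t t' ht ht' htt
      refine ⟨t • x + t' • y, fun i => convex_cheapestDemand (hXcvx i) (hqc i) _ _ (hx i) (hy i)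
        ht ht' htt, ?_⟩
      ext o
      cases o with
      | none => simp [ex]
      | some c =>
        simp only [ex, Option.elim_some, dotIO_combo, Pi.add_apply, Pi.smul_apply, smul_eq_mul]
        linear_combination κ / b c * b c * htt)
    (by
      have := hgraph.image (f := fun q => (q.1, ex q.2)) (by fun_prop)
      convert this using 1
      ext ⟨s, z⟩
      constructor
      · rintro ⟨hs, x, hx, rfl⟩
        exact ⟨(s, x), ⟨hs, hx⟩, rfl⟩
      · rintro ⟨⟨s', x⟩, ⟨hs, hx⟩, h⟩
        obtain ⟨rfl, rfl⟩ := Prod.mk.inj h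
        exact ⟨hs, x, hx, rfl⟩)
  set p := price s with hp
  have hp0 : ∀ c, 0 ≤ p c := hprice0 s hs
  have hv : dotProduct s (ex x) = ∑ c, p c * (dotIO (a c) x - b c) := by
    simp only [dotProduct, Fintype.sum_option, ex, Option.elim_none, mul_zero, zero_add,
      Option.elim_some, hp, price]
    exact sum_congr rfl fun c _ => by ring
  have hvnn : 0 ≤ dotProduct s (ex x) := hz none
  have hpb : ∑ c, p c * b c = κ * ∑ c, s (some c) := by
    rw [mul_sum]
    exact sum_congr rfl fun c _ => div_mul_cancel₀ _ (hb c).ne'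
  have hbudget : ∑ c, p c * dotIO (a c) x ≤ α * Fintype.card I + (1 - α) * ∑ c, p c * b c := by
    rw [← sum_dotO_pers]
    calc ∑ i, dotO (pers a p i) (x i) ≤ ∑ i, income a ω α p i :=
          sum_le_sum fun i _ => (hx i).2.1
      _ = α * Fintype.card I + (1 - α) * ∑ c, p c * dotIO (a c) ω := by
          simp only [income, sum_add_distrib, ← mul_sum, sum_dotO_pers, sum_const, card_univ,
            nsmul_eq_mul]
          ring
      _ ≤ _ := by
          have : ∑ c, p c * dotIO (a c) ω ≤ ∑ c, p c * b c :=
            sum_le_sum fun c _ => mul_le_mul_of_nonneg_left (hωb c) (hp0 c)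
          have := mul_le_mul_of_nonneg_left this (by linarith : 0 ≤ 1 - α)
          linarith
  have hv0 : dotProduct s (ex x) = 0 := by
    by_contra hne
    have hpos : 0 < dotProduct s (ex x) := lt_of_le_of_ne hvnn (Ne.symm hne)
    have hle : dotProduct s (ex x) ≤ (∑ c, s (some c)) * dotProduct s (ex x) := by
      conv_lhs => rw [dotProduct, Fintype.sum_option]
      rw [sum_mul]
      simp only [ex, Option.elim_none, mul_zero, zero_add]
      exact sum_le_sum fun c _ => mul_le_mul_of_nonneg_left (hz (some c)) (hs.1 _)
    have h1 : 1 ≤ ∑ c, s (some c) := by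
      by_contra! h
      nlinarith
    have h2 : κ ≤ ∑ c, p c * b c := by rw [hpb]; nlinarith
    simp only [mul_sub, sum_sub_distrib] at hv
    nlinarith
  have hfeas : ∀ c, dotIO (a c) x ≤ b c := by
    intro c
    have := hz (some c)
    rw [hv0] at this
    have h2 : 0 < κ / b c := div_pos hκ0 (hb c)
    by_contra! h
    exact absurd this (not_le.2 (mul_pos h2 (sub_pos.2 h)))
  refine ⟨x, p, hp0, hx, hfeas, fun c hc => ?_⟩
  rw [hv0] at hv
  have := (sum_eq_zero_iff_of_nonpos fun c _ =>
    mul_nonpos_of_nonneg_of_nonpos (hp0 c) (sub_nonpos.2 (hfeas c))).1 hv.symm c (mem_univ c)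
  exact (mul_eq_zero.1 this).resolve_right (sub_neg.2 hc).ne

/-- Cheapest demands that clear the market admit no Pareto improvement satisfying the
constraints. -/
lemma not_dominated_of_cheapestDemand (X : I → Set (O → ℝ)) (hXcvx : ∀ i, Convex ℝ (X i))
    (hX0 : ∀ i, (0 : O → ℝ) ∈ X i) (a : C → I → O → ℝ) (b : C → ℝ)
    (u : I → (O → ℝ) → ℝ) (hu : ∀ i, ContinuousOn (u i) (X i))
    (hssqc : ∀ i, ∀ z ∈ X i, ∀ w ∈ X i, ∀ t : ℝ, 0 < t → t < 1 → u i z ≠ u i w →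
      min (u i z) (u i w) < u i (t • z + (1 - t) • w))
    {x : I → O → ℝ} {p : C → ℝ} (hp : ∀ c, 0 ≤ p c) {m : I → ℝ} (hm : ∀ i, 0 < m i)
    (hx : ∀ i, x i ∈ cheapestDemand (u i) (X i) (pers a p i) (m i))
    (hfeas : ∀ c, dotIO (a c) x ≤ b c) (hslack : ∀ c, dotIO (a c) x < b c → p c = 0)
    {y : I → O → ℝ} (hy : ∀ i, y i ∈ X i) (hyb : ∀ c, dotIO (a c) y ≤ b c)
    (hle : ∀ i, u i (x i) ≤ u i (y i)) (j : I) : u j (y j) ≤ u j (x j) := by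
  by_contra! hlt
  have h1 : ∑ i, dotO (pers a p i) (x i) < ∑ i, dotO (pers a p i) (y i) := by
    refine sum_lt_sum
      (fun i _ => dotO_le_of_mem_cheapestDemand (hXcvx i) (hssqc i) (hx i) (hy i) (hle i))
      ⟨j, mem_univ j, (hx j).2.1.trans_lt ?_⟩
    by_contra! hyw
    exact absurd (le_of_mem_cheapestDemand (hXcvx j) (hX0 j) (hu j) (hm j) (hx j) (hy j) hyw)
      (not_le.2 hlt)
  rw [sum_dotO_pers, sum_dotO_pers] at h1
  refine absurd h1 (not_lt.2 (sum_le_sum fun c _ => ?_))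
  rcases (hfeas c).eq_or_lt with h | h
  · rw [h]
    exact mul_le_mul_of_nonneg_left (hyb c) (hp c)
  · simp [hslack c h]

end Prices

theorem statement5 {I O C : Type*} [Fintype I] [Fintype O] [Fintype C]
    [Nonempty I] [Nonempty O]
    (S : Finset (I → O → ℝ)) (hSne : S.Nonempty)
    (𝒞 : Set (I → O → ℝ)) (h𝒞 : 𝒞 = convexHull ℝ (S : Set (I → O → ℝ)))
    (h𝒞nn : ∀ x ∈ 𝒞, ∀ i l, 0 ≤ x i l)
    (X : I → Set (O → ℝ))
    (hXnn : ∀ i, ∀ z ∈ X i, ∀ l, 0 ≤ z l)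
    (hXcpt : ∀ i, IsCompact (X i))
    (hXcvx : ∀ i, Convex ℝ (X i))
    (hX0 : ∀ i, (0 : O → ℝ) ∈ X i)
    (hXdc : ∀ i, ∀ y z : O → ℝ, (∀ l, 0 ≤ y l) → (∀ l, y l ≤ z l) → z ∈ X i → y ∈ X i)
    (a : C → I → O → ℝ) (b : C → ℝ)
    (ha : ∀ c i l, 0 ≤ a c i l) (hb : ∀ c, 0 < b c)
    (hlcs : {x : I → O → ℝ | (∀ i l, 0 ≤ x i l) ∧ ∃ x' ∈ 𝒞, ∀ i l, x i l ≤ x' i l}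
      = {x : I → O → ℝ | (∀ i l, 0 ≤ x i l) ∧ (∀ i, x i ∈ X i) ∧ ∀ c, dotIO (a c) x ≤ b c})
    (u : I → (O → ℝ) → ℝ)
    (hu_cont : ∀ i, ContinuousOn (u i) {z : O → ℝ | ∀ l, 0 ≤ z l})
    (hu_qc : ∀ i, ∀ z ∈ {z : O → ℝ | ∀ l, 0 ≤ z l}, ∀ w ∈ {z : O → ℝ | ∀ l, 0 ≤ z l},
      ∀ t : ℝ, 0 ≤ t → t ≤ 1 → min (u i z) (u i w) ≤ u i (t • z + (1 - t) • w))
    (hu_ssqc : ∀ i, ∀ z ∈ {z : O → ℝ | ∀ l, 0 ≤ z l}, ∀ w ∈ {z : O → ℝ | ∀ l, 0 ≤ z l},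
      ∀ t : ℝ, 0 < t → t < 1 → u i z ≠ u i w →
        min (u i z) (u i w) < u i (t • z + (1 - t) • w))
    (hu_mono : ∀ i, ∀ z ∈ {z : O → ℝ | ∀ l, 0 ≤ z l}, ∀ w ∈ {z : O → ℝ | ∀ l, 0 ≤ z l},
      (∀ l, w l ≤ z l) → w ≠ z → u i w < u i z)
    (ω : I → O → ℝ) (hωX : ∀ i, ω i ∈ X i) (hω𝒞 : ω ∈ 𝒞)
    (hωc : ∀ c, 0 < dotIO (a c) ω)
    (α : ℝ) (hα0 : 0 < α) (hα1 : α ≤ 1) :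
    ∃ (x : I → O → ℝ) (p : C → ℝ),
      (∀ c, 0 ≤ p c) ∧
      (∀ i, x i ∈ X i ∧ dotO (pers a p i) (x i) ≤ α + (1 - α) * dotO (pers a p i) (ω i) ∧
        ∀ z ∈ X i, dotO (pers a p i) z ≤ α + (1 - α) * dotO (pers a p i) (ω i) → u i z ≤ u i (x i)) ∧
      x ∈ 𝒞 ∧
      (∀ c, dotIO (a c) x < b c → p c = 0) ∧
      (¬ ∃ y ∈ 𝒞, (∀ i, u i (x i) ≤ u i (y i)) ∧ ∃ j, u j (x j) < u j (y j)) := by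
  have hlcs' : ∀ x, ((∀ i l, 0 ≤ x i l) ∧ ∃ x' ∈ 𝒞, ∀ i l, x i l ≤ x' i l) ↔
      (∀ i l, 0 ≤ x i l) ∧ (∀ i, x i ∈ X i) ∧ ∀ c, dotIO (a c) x ≤ b c :=
    fun x => Set.ext_iff.1 hlcs x
  have h𝒞X : ∀ y ∈ 𝒞, (∀ i, y i ∈ X i) ∧ ∀ c, dotIO (a c) y ≤ b c := fun y hy =>
    ((hlcs' y).1 ⟨h𝒞nn y hy, y, hy, fun _ _ => le_rfl⟩).2
  have hu : ∀ i, ContinuousOn (u i) (X i) := fun i => (hu_cont i).mono (hXnn i)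
  obtain ⟨x, p, hp, hx, hfeas, hslack⟩ := exists_clearing_prices X hXcpt hXcvx hX0 a b ha hb u hu
    (fun i z hz w hw => hu_qc i z (hXnn i z hz) w (hXnn i w hw)) ω (h𝒞nn ω hω𝒞)
    (h𝒞X ω hω𝒞).2 α hα0 hα1
  have hm : ∀ i, 0 < income a ω α p i := fun i => by
    have : 0 ≤ dotO (pers a p i) (ω i) := sum_nonneg fun l _ =>
      mul_nonneg (sum_nonneg fun c _ => mul_nonneg (ha c i l) (hp c)) (h𝒞nn ω hω𝒞 i l)
    exact add_pos_of_pos_of_nonneg hα0 (mul_nonneg (by linarith) this)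
  have heff : ∀ y ∈ 𝒞, (∀ i, u i (x i) ≤ u i (y i)) → ∀ j, u j (y j) ≤ u j (x j) :=
    fun y hy hle => not_dominated_of_cheapestDemand X hXcvx hX0 a b u hu
      (fun i z hz w hw => hu_ssqc i z (hXnn i z hz) w (hXnn i w hw)) hp hm hx hfeas hslack
      (h𝒞X y hy).1 (h𝒞X y hy).2 hle
  have hx0 : ∀ i l, 0 ≤ x i l := fun i => hXnn i _ (hx i).1
  have hx𝒞 : x ∈ 𝒞 := by
    obtain ⟨-, x', hx', hle⟩ := (hlcs' x).2 ⟨hx0, fun i => (hx i).1, hfeas⟩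
    have hlt : ∀ i, x i ≠ x' i → u i (x i) < u i (x' i) := fun i =>
      hu_mono i _ (h𝒞nn x' hx' i) _ (hx0 i) (hle i)
    have hle' : ∀ i, u i (x i) ≤ u i (x' i) := fun i => by
      by_cases h : x i = x' i
      · rw [h]
      · exact (hlt i h).le
    have : x = x' := funext fun i => by
      by_contra h
      exact absurd (heff x' hx' hle' i) (not_le.2 (hlt i h))
    rwa [this]
  refine ⟨x, p, hp, fun i => ⟨(hx i).1, (hx i).2.1, fun z hz hzw => ?_⟩, hx𝒞, hslack, ?_⟩
  · exact le_of_mem_cheapestDemand (hXcvx i) (hX0 i) (hu i) (hm i) (hx i) hz hzw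
  · rintro ⟨y, hy, hle, j, hj⟩
    exact absurd (heff y hy hle j) (not_le.2 hj)
end

section
/- In the controlled school choice model with two student types, lcs(𝒞) equals the set of all x ∈ ℝ_{≥0}^{I×O} satisfying: Σ_{l∈O} x_{i,l} ≤ 1 for every student i; Σ_{i∈I} x_{i,l} ≤ q_l for every school l; Σ_{i∈I^m} Σ_{l∈O'} x_{i,l} ≤ q̄'^m_{O'} for every nonempty O' ⊆ O; and Σ_{i∈I^M} Σ_{l∈O'} x_{i,l} ≤ q̄'^M_{O'} for every nonempty O' ⊆ O, where q̄'^m and q̄'^M are the modified ceiling quotas. -/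
open Finset

/-- The part of a horizontal bar of length `a` that lies above the unit interval `[s, s + 1]`. -/
noncomputable def slotWeight (a : ℝ) (s : ℕ) : ℝ := max 0 (min 1 (a - s))

lemma slotWeight_nonneg (a : ℝ) (s : ℕ) : 0 ≤ slotWeight a s := le_max_left _ _

lemma slotWeight_eq_zero {a : ℝ} {s : ℕ} (h : a ≤ s) : slotWeight a s = 0 :=
  max_eq_left ((min_le_right _ _).trans (by linarith))

lemma slotWeight_eq_one {a : ℝ} {s : ℕ} (h : (s : ℝ) + 1 ≤ a) : slotWeight a s = 1 := by
  rw [slotWeight, min_eq_left (by linarith), max_eq_right zero_le_one]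

lemma sum_slotWeight {a : ℝ} (ha : 0 ≤ a) {n : ℕ} (han : a ≤ n) :
    ∑ s : Fin n, slotWeight a s = a := by
  have key : ∀ k : ℕ, ∑ s ∈ range k, slotWeight a s = min a k := by
    intro k
    induction k with
    | zero => simp [ha]
    | succ k ih =>
      rw [sum_range_succ, ih]
      push_cast
      rcases le_total a k with h | h
      · rw [slotWeight_eq_zero h, min_eq_left h, add_zero, min_eq_left (by linarith)]
      · rw [slotWeight]
        rcases le_total a (k + 1) with h' | h'
        · rw [min_eq_right h, min_eq_left h', min_eq_right (by linarith),
            max_eq_right (by linarith)]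
          ring
        · rw [min_eq_right h, min_eq_right h', min_eq_left (by linarith),
            max_eq_right zero_le_one]
  rw [Fin.sum_univ_eq_sum_range (fun s => slotWeight a s), key, min_eq_left han]

lemma slotWeight_add_slotWeight_rev_le {n : ℕ} {a b : ℝ} (hab : a + b ≤ n) (s : Fin n) :
    slotWeight a s + slotWeight b s.rev ≤ 1 := by
  have hs : ((s.rev : ℕ) : ℝ) = n - (s + 1) := by
    rw [Fin.val_rev, Nat.cast_sub s.isLt]; push_cast; rfl
  unfold slotWeight
  rw [hs]
  rcases le_total 0 (min 1 (a - s)) with h1 | h1 <;>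
  rcases le_total 0 (min 1 (b - (n - ((s : ℝ) + 1)))) with h2 | h2
  · rw [max_eq_right h1, max_eq_right h2]
    linarith [min_le_right 1 (a - s), min_le_right 1 (b - (n - ((s : ℝ) + 1)))]
  · rw [max_eq_right h1, max_eq_left h2]
    linarith [min_le_left 1 (a - s)]
  · rw [max_eq_left h1, max_eq_right h2]
    linarith [min_le_left 1 (b - (n - ((s : ℝ) + 1)))]
  · rw [max_eq_left h1, max_eq_left h2]
    norm_num

lemma sum_fin_le_of_eq_zero {n b : ℕ} {c : Fin n → ℕ} (h1 : ∀ s, c s ≤ 1)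
    (h0 : ∀ s : Fin n, b ≤ s → c s = 0) : ∑ s, c s ≤ b := by
  calc ∑ s, c s ≤ ∑ s : Fin n, if (s : ℕ) < b then 1 else 0 := by
        refine sum_le_sum fun s _ => ?_
        split_ifs with h
        · exact h1 s
        · exact (h0 s (not_lt.mp h)).le
    _ = #{s : Fin n | (s : ℕ) < b} := by rw [sum_boole]; rfl
    _ = #((univ.filter fun s : Fin n => (s : ℕ) < b).map Fin.valEmbedding) := (card_map _).symm
    _ ≤ #(range b) := card_le_card fun k hk => by
        simp only [mem_map, mem_filter, mem_univ, true_and] at hk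
        obtain ⟨s, hs, rfl⟩ := hk
        exact mem_range.mpr hs
    _ = b := card_range b

lemma le_sum_fin_of_one_le {n a : ℕ} {c : Fin n → ℕ} (han : a ≤ n)
    (h1 : ∀ s : Fin n, (s : ℕ) < a → 1 ≤ c s) : a ≤ ∑ s, c s := by
  calc a = ∑ _s : Fin a, 1 := by simp
    _ ≤ ∑ s : Fin a, c (Fin.castLE han s) := sum_le_sum fun s _ => h1 _ s.isLt
    _ = ∑ s ∈ univ.map (Fin.castLEEmb han), c s := by rw [sum_map]; rfl
    _ ≤ ∑ s, c s := sum_le_sum_of_subset (subset_univ _)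

/-- A doubly substochastic matrix is a convex combination of partial matchings which use only
its support and which cover every column of sum one. -/
theorem mem_convexHull_matchings {I S : Type*} [Fintype I] [Fintype S]
    (y : I → S → ℝ) (hy : ∀ i s, 0 ≤ y i s) (hrow : ∀ i, ∑ s, y i s ≤ 1)
    (hcol : ∀ s, ∑ i, y i s ≤ 1) :
    y ∈ convexHull ℝ {z : I → S → ℝ | ∃ n : I → S → ℕ, (∀ i s, z i s = n i s) ∧
      (∀ i, ∑ s, n i s ≤ 1) ∧ (∀ s, ∑ i, n i s ≤ 1) ∧ (∀ i s, y i s = 0 → n i s = 0) ∧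
      (∀ s, ∑ i, y i s = 1 → ∑ i, n i s = 1)} := by
  classical
  set B : Matrix (I ⊕ S) (I ⊕ S) ℝ := Matrix.fromBlocks
    (Matrix.diagonal fun i => 1 - ∑ s, y i s) (Matrix.of y) (Matrix.of y).transpose
    (Matrix.diagonal fun s => 1 - ∑ i, y i s) with hB
  have hBmem : B ∈ doublyStochastic ℝ (I ⊕ S) := by
    rw [mem_doublyStochastic_iff_sum]
    refine ⟨?_, ?_, ?_⟩
    · rintro (i | s) (j | t)
      · by_cases h : i = j
        · subst h; simpa [hB] using hrow i
        · simp [hB, h]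
      · simpa [hB] using hy i t
      · simpa [hB] using hy j s
      · by_cases h : s = t
        · subst h; simpa [hB] using hcol s
        · simp [hB, h]
    · rintro (i | s) <;> simp [hB, Matrix.diagonal_apply]
    · rintro (i | s) <;> simp [hB, Matrix.diagonal_apply]
  obtain ⟨w, hw0, hw1, hwB⟩ := exists_eq_sum_perm_of_mem_doublyStochastic hBmem
  have hentry : ∀ u v, B u v = ∑ σ : Equiv.Perm (I ⊕ S), w σ * (if σ u = v then 1 else 0) := by
    intro u v
    rw [← hwB, Matrix.sum_apply]
    refine sum_congr rfl fun σ _ => ?_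
    simp [Equiv.Perm.permMatrix, PEquiv.toMatrix_apply, Equiv.toPEquiv_apply, eq_comm]
  have hsupp : ∀ σ, w σ ≠ 0 → ∀ u v, B u v = 0 → σ u ≠ v := by
    intro σ hσ u v huv hv
    rw [hentry, sum_eq_zero_iff_of_nonneg
      (fun τ _ => mul_nonneg (hw0 τ) (by split_ifs <;> norm_num))] at huv
    simpa [hv, hσ] using huv σ (mem_univ σ)
  let n : Equiv.Perm (I ⊕ S) → I → S → ℕ := fun σ i s => if σ (.inl i) = .inr s then 1 else 0
  have hysum : y = ∑ σ with w σ ≠ 0, w σ • fun i s => (n σ i s : ℝ) := by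
    ext i s
    have h := hentry (.inl i) (.inr s)
    rw [← sum_filter_of_ne (p := fun σ => w σ ≠ 0)
      (fun σ _ h => left_ne_zero_of_mul h)] at h
    simpa [hB, n, Finset.sum_apply] using h
  rw [hysum]
  refine (convex_convexHull ℝ _).sum_mem (fun σ _ => hw0 σ) ?_ fun σ hσ => subset_convexHull ℝ _ ?_
  · rw [sum_filter_ne_zero, hw1]
  rw [← hysum]
  have hσ' : w σ ≠ 0 := (mem_filter.mp hσ).2
  have hcolN : ∀ s, ∑ i, n σ i s = if ∃ i, σ (.inl i) = .inr s then 1 else 0 := by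
    intro s
    split_ifs with h
    · obtain ⟨i, hi⟩ := h
      rw [sum_eq_single i]
      · simp [n, hi]
      · intro j _ hj
        have : σ (.inl j) ≠ .inr s := fun h =>
          hj (Sum.inl_injective (σ.injective (h.trans hi.symm)))
        simp [n, this]
      · simp
    · push Not at h
      exact sum_eq_zero fun i _ => if_neg (h i)
  refine ⟨n σ, fun _ _ => rfl, fun i => ?_, fun s => ?_, fun i s h => ?_, fun s h => ?_⟩
  · rcases hi : σ (.inl i) with j | s
    · simp [n, hi]
    · simp [n, hi]
  · rw [hcolN]; split_ifs <;> norm_num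
  · exact if_neg (hsupp σ hσ' _ _ (by simpa [hB] using h))
  · rw [hcolN, if_pos]
    rcases hu : σ.symm (.inr s) with i | t
    · exact ⟨i, by rw [← hu, Equiv.apply_symm_apply]⟩
    · exfalso
      refine hsupp σ hσ' (.inr t) (.inr s) ?_ (by rw [← hu, Equiv.apply_symm_apply])
      by_cases hts : t = s
      · subst hts; simp [hB, h]
      · simp [hB, hts]

/-- Unused row capacity of the rows in `T` suffices to raise the column sums to any targets of
total at most `#T`. -/
lemma exists_ge_sum_eq {I O : Type*} [Fintype O] {T : Finset I} {x : I → O → ℝ}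
    (hrow : ∀ i, ∑ l, x i l ≤ 1)
    {t : O → ℝ} (ht : ∀ l, ∑ i ∈ T, x i l ≤ t l) (htot : ∑ l, t l ≤ #T) :
    ∃ y : I → O → ℝ, (∀ i l, x i l ≤ y i l) ∧ (∀ i, ∑ l, y i l ≤ 1) ∧
      ∀ l, ∑ i ∈ T, y i l = t l := by
  set g : I → ℝ := fun i => 1 - ∑ l, x i l with hgdef
  set R : ℝ := ∑ i ∈ T, g i with hR
  have hg : ∀ i, 0 ≤ g i := fun i => by simpa [hgdef] using hrow i
  have hR0 : 0 ≤ R := sum_nonneg fun i _ => hg i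
  have hd : ∀ l, 0 ≤ t l - ∑ i ∈ T, x i l := fun l => sub_nonneg.mpr (ht l)
  have hdR : ∑ l, (t l - ∑ i ∈ T, x i l) ≤ R := by
    rw [hR, hgdef, sum_sub_distrib, sum_sub_distrib, sum_comm (s := T)]
    simpa using htot
  refine ⟨fun i l => x i l + g i * ((t l - ∑ j ∈ T, x j l) / R), fun i l => ?_, fun i => ?_,
    fun l => ?_⟩
  · exact le_add_of_nonneg_right (mul_nonneg (hg i) (div_nonneg (hd l) hR0))
  · rw [sum_add_distrib, ← mul_sum, ← sum_div]
    have := mul_le_mul_of_nonneg_left (div_le_one_of_le₀ hdR hR0) (hg i)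
    simp only [hgdef] at this ⊢
    linarith
  · rw [sum_add_distrib, ← sum_mul, ← hR, mul_div_cancel_of_imp', add_sub_cancel]
    intro h
    have h0 : ∑ l, (t l - ∑ i ∈ T, x i l) = 0 :=
      le_antisymm (h ▸ hdR) (sum_nonneg fun l _ => hd l)
    exact (sum_eq_zero_iff_of_nonneg fun l _ => hd l).mp h0 l (mem_univ l)

section Assignments

variable {I O : Type*} [Fintype I] [Fintype O]

/-- Deterministic assignments: type `Im` has floors `a` and ceilings `b`, type `IM` has floors `c`
and ceilings `d`, and the capacities are `q`. -/
def deterministicAssignments (Im IM : Finset I) (q a b c d : O → ℕ) : Set (I → O → ℝ) :=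
  {x : I → O → ℝ |
    (∀ i l, x i l = 0 ∨ x i l = 1) ∧
    (∀ i, ∑ l, x i l ≤ 1) ∧
    (∀ l, ∑ i, x i l ≤ (q l : ℝ)) ∧
    (∀ l, (a l : ℝ) ≤ ∑ i ∈ Im, x i l ∧ ∑ i ∈ Im, x i l ≤ (b l : ℝ)) ∧
    (∀ l, (c l : ℝ) ≤ ∑ i ∈ IM, x i l ∧ ∑ i ∈ IM, x i l ≤ (d l : ℝ))}

/-- The linear relaxation of `deterministicAssignments`. -/
def fractionalAssignments (Im IM : Finset I) (q a b c d : O → ℕ) : Set (I → O → ℝ) :=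
  {x : I → O → ℝ |
    (∀ i l, 0 ≤ x i l) ∧
    (∀ i, ∑ l, x i l ≤ 1) ∧
    (∀ l, ∑ i, x i l ≤ (q l : ℝ)) ∧
    (∀ l, (a l : ℝ) ≤ ∑ i ∈ Im, x i l ∧ ∑ i ∈ Im, x i l ≤ (b l : ℝ)) ∧
    (∀ l, (c l : ℝ) ≤ ∑ i ∈ IM, x i l ∧ ∑ i ∈ IM, x i l ≤ (d l : ℝ))}

lemma convex_fractionalAssignments (Im IM : Finset I) (q a b c d : O → ℕ) :
    Convex ℝ (fractionalAssignments Im IM q a b c d) := by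
  have hl : ∀ {X Y r s t : ℝ}, 0 ≤ s → 0 ≤ t → s + t = 1 → X ≤ r → Y ≤ r → s * X + t * Y ≤ r :=
    fun {_ _ r _ _} hs ht hst hX hY => convex_Iic r hX hY hs ht hst
  have hg : ∀ {X Y r s t : ℝ}, 0 ≤ s → 0 ≤ t → s + t = 1 → r ≤ X → r ≤ Y → r ≤ s * X + t * Y :=
    fun {_ _ r _ _} hs ht hst hX hY => convex_Ici r hX hY hs ht hst
  rintro x ⟨x0, x1, x2, x3, x4⟩ y ⟨y0, y1, y2, y3, y4⟩ s t hs ht hst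
  simp only [fractionalAssignments, Set.mem_ofPred_eq, Pi.add_apply, Pi.smul_apply, smul_eq_mul,
    sum_add_distrib, ← mul_sum]
  exact ⟨fun i l => hg hs ht hst (x0 i l) (y0 i l), fun i => hl hs ht hst (x1 i) (y1 i),
    fun l => hl hs ht hst (x2 l) (y2 l),
    fun l => ⟨hg hs ht hst (x3 l).1 (y3 l).1, hl hs ht hst (x3 l).2 (y3 l).2⟩,
    fun l => ⟨hg hs ht hst (x4 l).1 (y4 l).1, hl hs ht hst (x4 l).2 (y4 l).2⟩⟩

lemma sum_add_sum_of_partition [DecidableEq I] {Im IM : Finset I} (hcover : Im ∪ IM = univ)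
    (hdisj : Disjoint Im IM) {M : Type*} [AddCommMonoid M] (f : I → M) :
    ∑ i ∈ Im, f i + ∑ i ∈ IM, f i = ∑ i, f i := by
  rw [← sum_union hdisj, hcover]

theorem fractionalAssignments_subset_convexHull [DecidableEq I] {Im IM : Finset I}
    (hcover : Im ∪ IM = univ) (hdisj : Disjoint Im IM) (q a b c d : O → ℕ) :
    fractionalAssignments Im IM q a b c d ⊆
      convexHull ℝ (deterministicAssignments Im IM q a b c d) := by
  rintro x ⟨x0, x1, x2, x3, x4⟩
  set m : O → ℝ := fun l => ∑ i ∈ Im, x i l with hm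
  set M : O → ℝ := fun l => ∑ i ∈ IM, x i l with hM
  have hm0 : ∀ l, 0 ≤ m l := fun l => sum_nonneg fun i _ => x0 i l
  have hM0 : ∀ l, 0 ≤ M l := fun l => sum_nonneg fun i _ => x0 i l
  have hmM : ∀ l, m l + M l ≤ q l := fun l => by
    rw [hm, hM]; simp only [sum_add_sum_of_partition hcover hdisj]; exact x2 l
  have hnot : ∀ {i}, i ∈ IM → i ∉ Im := fun hi h => disjoint_left.mp hdisj h hi
  have hIM : ∀ {i}, i ∉ Im → i ∈ IM := fun {i} hi => by
    have := mem_univ i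
    rw [← hcover, mem_union] at this
    exact this.resolve_left hi
  let y : I → (Σ l, Fin (q l)) → ℝ := fun i p =>
    if i ∈ Im then x i p.1 * slotWeight (m p.1) p.2 / m p.1
    else x i p.1 * slotWeight (M p.1) p.2.rev / M p.1
  have hy0 : ∀ i p, 0 ≤ y i p := by
    intro i p
    simp only [y]
    split_ifs
    · exact div_nonneg (mul_nonneg (x0 _ _) (slotWeight_nonneg _ _)) (hm0 _)
    · exact div_nonneg (mul_nonneg (x0 _ _) (slotWeight_nonneg _ _)) (hM0 _)
  have hsum : ∀ i l, ∑ s, y i ⟨l, s⟩ = x i l := by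
    intro i l
    by_cases hi : i ∈ Im
    · simp only [y, if_pos hi]
      rw [← sum_div, ← mul_sum, sum_slotWeight (hm0 l) (by linarith [hmM l, hM0 l])]
      refine mul_div_cancel_of_imp fun h => ?_
      exact (sum_eq_zero_iff_of_nonneg fun j _ => x0 j l).mp h i hi
    · simp only [y, if_neg hi]
      rw [← sum_div, ← mul_sum, show ∑ s : Fin (q l), slotWeight (M l) s.rev = M l from
        (Equiv.sum_comp Fin.revPerm fun s : Fin (q l) => slotWeight (M l) s).trans
          (sum_slotWeight (hM0 l) (by linarith [hmM l, hm0 l]))]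
      refine mul_div_cancel_of_imp fun h => ?_
      exact (sum_eq_zero_iff_of_nonneg fun j _ => x0 j l).mp h i (hIM hi)
  have hcolm : ∀ l (s : Fin (q l)), ∑ i ∈ Im, y i ⟨l, s⟩ = slotWeight (m l) s := by
    intro l s
    rw [sum_congr rfl fun i hi => show y i ⟨l, s⟩ = x i l * slotWeight (m l) s / m l from
      if_pos hi, ← sum_div, ← sum_mul]
    refine mul_div_cancel_left_of_imp fun h => ?_
    exact slotWeight_eq_zero (h.trans_le (Nat.cast_nonneg _))
  have hcolM : ∀ l (s : Fin (q l)), ∑ i ∈ IM, y i ⟨l, s⟩ = slotWeight (M l) s.rev := by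
    intro l s
    rw [sum_congr rfl fun i hi => show y i ⟨l, s⟩ = x i l * slotWeight (M l) s.rev / M l from
      if_neg (hnot hi), ← sum_div, ← sum_mul]
    refine mul_div_cancel_left_of_imp fun h => ?_
    exact slotWeight_eq_zero (h.trans_le (Nat.cast_nonneg _))
  have hcol : ∀ p : Σ l, Fin (q l), ∑ i, y i p = slotWeight (m p.1) p.2 +
      slotWeight (M p.1) p.2.rev := fun ⟨l, s⟩ => by
    rw [← sum_add_sum_of_partition hcover hdisj, hcolm, hcolM]
  have hcol1 : ∀ p : Σ l, Fin (q l), ∑ i, y i p ≤ 1 := fun p => by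
    rw [hcol]; exact slotWeight_add_slotWeight_rev_le (hmM _) _
  have hy := mem_convexHull_matchings y hy0
    (fun i => by rw [Fintype.sum_sigma, sum_congr rfl fun l _ => hsum i l]; exact x1 i) hcol1
  let L : (I → (Σ l, Fin (q l)) → ℝ) →ₗ[ℝ] (I → O → ℝ) :=
    { toFun := fun z i l => ∑ s, z i ⟨l, s⟩
      map_add' := fun z z' => by ext i l; simp [sum_add_distrib]
      map_smul' := fun r z => by ext i l; simp [mul_sum] }
  have hLy : L y = x := by ext i l; exact hsum i l
  rw [← hLy]
  have hLmem := Set.mem_image_of_mem L hy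
  rw [LinearMap.image_convexHull] at hLmem
  refine convexHull_mono ?_ hLmem
  rintro _ ⟨z, ⟨n, hzn, nrow, ncol, nsupp, nfull⟩, rfl⟩
  have hL : ∀ i l, L z i l = ((∑ s, n i ⟨l, s⟩ : ℕ) : ℝ) := fun i l => by
    change ∑ s, z i ⟨l, s⟩ = _
    rw [Nat.cast_sum]; exact sum_congr rfl fun s _ => hzn i ⟨l, s⟩
  have hrow : ∀ i, ∑ l, ∑ s, n i ⟨l, s⟩ ≤ 1 := fun i => by
    rw [← Fintype.sum_sigma]; exact nrow i
  have hpart : ∀ p, ∑ i ∈ Im, n i p + ∑ i ∈ IM, n i p = ∑ i, n i p := fun p =>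
    sum_add_sum_of_partition hcover hdisj fun i => n i p
  have hzero : ∀ (T : Finset I) p, ∑ i ∈ T, y i p = 0 → ∑ i ∈ T, n i p = 0 := fun T p h =>
    sum_eq_zero fun i hi =>
      nsupp i p ((sum_eq_zero_iff_of_nonneg fun j _ => hy0 j p).mp h i hi)
  simp only [deterministicAssignments, Set.mem_ofPred_eq, hL, ← Nat.cast_sum, Nat.cast_le,
    Nat.cast_le_one]
  refine ⟨fun i l => ?_, hrow, fun l => ?_, fun l => ⟨?_, ?_⟩, fun l => ⟨?_, ?_⟩⟩
  · have : ∑ s, n i ⟨l, s⟩ ≤ 1 := (single_le_sum (f := fun l => ∑ s, n i ⟨l, s⟩)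
      (fun _ _ => Nat.zero_le _) (mem_univ l)).trans (hrow i)
    exact_mod_cast Nat.le_one_iff_eq_zero_or_eq_one.mp this
  · rw [sum_comm]
    exact (sum_le_sum fun s _ => ncol ⟨l, s⟩).trans (by simp)
  · rw [sum_comm]
    have haq : (a l : ℝ) ≤ q l := by linarith [(x3 l).1, hmM l, hM0 l]
    refine le_sum_fin_of_one_le (by exact_mod_cast haq) fun s hs => ?_
    have hs' : ((s : ℕ) : ℝ) + 1 ≤ a l := by exact_mod_cast hs
    have h1 : slotWeight (m l) s = 1 := slotWeight_eq_one (hs'.trans (x3 l).1)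
    have h2 : slotWeight (M l) s.rev = 0 := le_antisymm
      (by linarith [slotWeight_add_slotWeight_rev_le (hmM l) s]) (slotWeight_nonneg _ _)
    have h3 := hzero IM ⟨l, s⟩ ((hcolM l s).trans h2)
    have h4 := nfull ⟨l, s⟩ (by rw [hcol]; simp only [h1, h2, add_zero])
    have h5 := hpart ⟨l, s⟩
    omega
  · rw [sum_comm]
    refine sum_fin_le_of_eq_zero (fun s => ?_) fun s hs => ?_
    · have h4 := ncol ⟨l, s⟩
      have h5 := hpart ⟨l, s⟩
      omega
    · exact hzero Im ⟨l, s⟩ ((hcolm l s).trans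
        (slotWeight_eq_zero ((x3 l).2.trans (by exact_mod_cast hs))))
  · rw [sum_comm, ← Equiv.sum_comp Fin.revPerm]
    have haq : (c l : ℝ) ≤ q l := by linarith [(x4 l).1, hmM l, hm0 l]
    refine le_sum_fin_of_one_le (by exact_mod_cast haq) fun s hs => ?_
    simp only [Fin.revPerm_apply]
    have hs' : ((s : ℕ) : ℝ) + 1 ≤ c l := by exact_mod_cast hs
    have h1 : slotWeight (M l) s.rev.rev = 1 := by
      rw [Fin.rev_rev]; exact slotWeight_eq_one (hs'.trans (x4 l).1)
    have h2 : slotWeight (m l) s.rev = 0 := le_antisymm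
      (by linarith [slotWeight_add_slotWeight_rev_le (hmM l) s.rev]) (slotWeight_nonneg _ _)
    have h3 := hzero Im ⟨l, s.rev⟩ ((hcolm l s.rev).trans h2)
    have h4 := nfull ⟨l, s.rev⟩ (by rw [hcol]; simp only [h1, h2, zero_add])
    have h5 := hpart ⟨l, s.rev⟩
    omega
  · rw [sum_comm, ← Equiv.sum_comp Fin.revPerm]
    refine sum_fin_le_of_eq_zero (fun s => ?_) fun s hs => ?_
    · simp only [Fin.revPerm_apply]
      have h4 := ncol ⟨l, s.rev⟩
      have h5 := hpart ⟨l, s.rev⟩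
      omega
    · refine hzero IM ⟨l, s.rev⟩ ((hcolM l s.rev).trans ?_)
      rw [Fin.rev_rev]
      exact slotWeight_eq_zero ((x4 l).2.trans (by exact_mod_cast hs))

/-- The integrality of the assignment polytope. -/
theorem convexHull_deterministicAssignments [DecidableEq I] {Im IM : Finset I}
    (hcover : Im ∪ IM = univ) (hdisj : Disjoint Im IM) (q a b c d : O → ℕ) :
    convexHull ℝ (deterministicAssignments Im IM q a b c d) =
      fractionalAssignments Im IM q a b c d := by
  refine (convexHull_min ?_ (convex_fractionalAssignments Im IM q a b c d)).antisymm
    (fractionalAssignments_subset_convexHull hcover hdisj q a b c d)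
  rintro x ⟨x0, hx⟩
  exact ⟨fun i l => by rcases x0 i l with h | h <;> simp [h], hx⟩

end Assignments

section Quotas

variable {O : Type*} [Fintype O] [DecidableEq O] {N : ℕ} {f b : O → ℕ} {r : O → ℤ}
  {Q : Finset O → ℤ}

lemma modifiedQuota_le
    (h1 : ∀ l, Q {l} = min (min (b l : ℤ) (r l)) ((N : ℤ) - ∑ l' ∈ univ.erase l, (f l' : ℤ)))
    (hrec : ∀ O' : Finset O, ∀ hO' : 2 ≤ O'.card,
      Q O' = min (O'.inf' (Finset.card_pos.mp (by omega)) fun l => Q (O'.erase l) + Q {l})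
        ((N : ℤ) - ∑ l' ∈ O'ᶜ, (f l' : ℤ)))
    {O' : Finset O} (hO' : O'.Nonempty) :
    Q O' ≤ (N : ℤ) - ∑ l ∈ O'ᶜ, (f l : ℤ) := by
  rcases Nat.lt_or_ge O'.card 2 with h | h
  · obtain ⟨l, rfl⟩ := card_eq_one.mp (show #O' = 1 by have := hO'.card_pos; omega)
    rw [h1, ← sdiff_singleton_eq_erase, ← compl_eq_univ_sdiff]
    exact min_le_right _ _
  · rw [hrec O' h]
    exact min_le_right _ _

lemma sum_le_modifiedQuota
    (h1 : ∀ l, Q {l} = min (min (b l : ℤ) (r l)) ((N : ℤ) - ∑ l' ∈ univ.erase l, (f l' : ℤ)))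
    (hrec : ∀ O' : Finset O, ∀ hO' : 2 ≤ O'.card,
      Q O' = min (O'.inf' (Finset.card_pos.mp (by omega)) fun l => Q (O'.erase l) + Q {l})
        ((N : ℤ) - ∑ l' ∈ O'ᶜ, (f l' : ℤ)))
    {m : O → ℝ} (hb : ∀ l, m l ≤ b l) (hr : ∀ l, m l ≤ r l)
    (hN : ∀ O' : Finset O, ∑ l ∈ O', m l ≤ (N : ℝ) - ∑ l ∈ O'ᶜ, (f l : ℝ))
    {O' : Finset O} (hO' : O'.Nonempty) : ∑ l ∈ O', m l ≤ Q O' := by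
  have hsing : ∀ l, m l ≤ Q {l} := fun l => by
    rw [h1, ← sdiff_singleton_eq_erase, ← compl_eq_univ_sdiff]
    push_cast
    exact le_min (le_min (hb l) (hr l)) (by simpa using hN {l})
  induction hc : #O' using Nat.strong_induction_on generalizing O' with
  | _ k ih =>
    rcases Nat.lt_or_ge O'.card 2 with h | h
    · obtain ⟨l, rfl⟩ := card_eq_one.mp (show #O' = 1 by have := hO'.card_pos; omega)
      simpa using hsing l
    · obtain ⟨l, hl, hmin⟩ := exists_mem_eq_inf' hO' fun l => Q (O'.erase l) + Q {l}
      have hcard := card_erase_of_mem hl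
      rw [hrec O' h, hmin]
      push_cast
      refine le_min ?_ (hN O')
      rw [← sum_erase_add _ _ hl]
      exact add_le_add (ih _ (by omega) (card_pos.mp (by omega)) rfl) (hsing l)

lemma sum_max_le_of_le_modifiedQuota
    (h1 : ∀ l, Q {l} = min (min (b l : ℤ) (r l)) ((N : ℤ) - ∑ l' ∈ univ.erase l, (f l' : ℤ)))
    (hrec : ∀ O' : Finset O, ∀ hO' : 2 ≤ O'.card,
      Q O' = min (O'.inf' (Finset.card_pos.mp (by omega)) fun l => Q (O'.erase l) + Q {l})
        ((N : ℤ) - ∑ l' ∈ O'ᶜ, (f l' : ℤ)))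
    (hf : ∑ l, f l ≤ N) {m : O → ℝ}
    (hQ : ∀ O' : Finset O, O'.Nonempty → ∑ l ∈ O', m l ≤ Q O') :
    ∑ l, max (m l) (f l : ℝ) ≤ N := by
  set S : Finset O := univ.filter fun l => (f l : ℝ) < m l with hS
  have hin : ∑ l ∈ S, max (m l) (f l : ℝ) = ∑ l ∈ S, m l :=
    sum_congr rfl fun l hl => max_eq_left (mem_filter.mp hl).2.le
  have hout : ∑ l ∈ Sᶜ, max (m l) (f l : ℝ) = ∑ l ∈ Sᶜ, (f l : ℝ) :=
    sum_congr rfl fun l hl => max_eq_right (by simpa [hS] using hl)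
  rw [← sum_add_sum_compl S, hin, hout]
  rcases S.eq_empty_or_nonempty with h | h
  · rw [h, sum_empty, zero_add, compl_empty]
    exact_mod_cast hf
  · have h2 : (Q S : ℝ) ≤ (N : ℝ) - ∑ l ∈ Sᶜ, (f l : ℝ) := by
      exact_mod_cast modifiedQuota_le h1 hrec h
    linarith [hQ S h]

end Quotas

theorem statement10 {I O : Type*} [Fintype I] [Fintype O] [DecidableEq I] [DecidableEq O]
    (Im IM : Finset I) (hcover : Im ∪ IM = univ) (hdisj : Disjoint Im IM)
    (q : O → ℕ) (hq : ∀ l, 0 < q l)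
    (qml qmh qMl qMh : O → ℕ)
    (hm : ∀ l, qml l ≤ qmh l) (hM : ∀ l, qMl l ≤ qMh l)
    (hsum : ∀ l, qml l + qMl l ≤ q l)
    (hmq : ∀ l, qml l ≤ q l) (hMq : ∀ l, qMl l ≤ q l)
    (hNm : ∑ l, qml l ≤ Im.card) (hNM : ∑ l, qMl l ≤ IM.card)
    (hcap : Im.card + IM.card ≤ ∑ l, q l)
    (𝒞 : Set (I → O → ℝ))
    (h𝒞 : 𝒞 = convexHull ℝ {x : I → O → ℝ |
      (∀ i l, x i l = 0 ∨ x i l = 1) ∧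
      (∀ i, ∑ l, x i l ≤ 1) ∧
      (∀ l, ∑ i, x i l ≤ (q l : ℝ)) ∧
      (∀ l, (qml l : ℝ) ≤ ∑ i ∈ Im, x i l ∧ ∑ i ∈ Im, x i l ≤ (qmh l : ℝ)) ∧
      (∀ l, (qMl l : ℝ) ≤ ∑ i ∈ IM, x i l ∧ ∑ i ∈ IM, x i l ≤ (qMh l : ℝ))})
    (q'm q'M : Finset O → ℤ)
    (hm1 : ∀ l, q'm {l} = min (min (qmh l : ℤ) ((q l : ℤ) - (qMl l : ℤ)))
      ((Im.card : ℤ) - ∑ l' ∈ univ.erase l, (qml l' : ℤ)))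
    (hM1 : ∀ l, q'M {l} = min (min (qMh l : ℤ) ((q l : ℤ) - (qml l : ℤ)))
      ((IM.card : ℤ) - ∑ l' ∈ univ.erase l, (qMl l' : ℤ)))
    (hmrec : ∀ O' : Finset O, ∀ hO' : 2 ≤ O'.card,
      q'm O' = min (O'.inf' (Finset.card_pos.mp (by omega)) fun l => q'm (O'.erase l) + q'm {l})
        ((Im.card : ℤ) - ∑ l' ∈ O'ᶜ, (qml l' : ℤ)))
    (hMrec : ∀ O' : Finset O, ∀ hO' : 2 ≤ O'.card,
      q'M O' = min (O'.inf' (Finset.card_pos.mp (by omega)) fun l => q'M (O'.erase l) + q'M {l})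
        ((IM.card : ℤ) - ∑ l' ∈ O'ᶜ, (qMl l' : ℤ))) :
    {x : I → O → ℝ | (∀ i l, 0 ≤ x i l) ∧ ∃ x' ∈ 𝒞, ∀ i l, x i l ≤ x' i l}
      = {x : I → O → ℝ | (∀ i l, 0 ≤ x i l) ∧
          (∀ i, ∑ l, x i l ≤ 1) ∧
          (∀ l, ∑ i, x i l ≤ (q l : ℝ)) ∧
          (∀ O' : Finset O, O'.Nonempty →
            ∑ i ∈ Im, ∑ l ∈ O', x i l ≤ ((q'm O' : ℤ) : ℝ)) ∧
          (∀ O' : Finset O, O'.Nonempty →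
            ∑ i ∈ IM, ∑ l ∈ O', x i l ≤ ((q'M O' : ℤ) : ℝ))} := by
  have hP := convexHull_deterministicAssignments hcover hdisj q qml qmh qMl qMh
  rw [deterministicAssignments, ← h𝒞] at hP
  rw [hP]
  ext x
  have hcap_le : ∀ {u v : ℝ} {l : O} {k : ℕ}, u + v ≤ q l → (k : ℝ) ≤ v → u ≤ ((q l - k : ℤ) : ℝ) :=
    fun h h' => by push_cast; linarith
  constructor
  · rintro ⟨x0, y, ⟨y0, y1, y2, y3, y4⟩, hxy⟩
    have hN : ∀ (T : Finset I) (f : O → ℕ), (∀ l, (f l : ℝ) ≤ ∑ i ∈ T, y i l) →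
        ∀ O' : Finset O, ∑ l ∈ O', ∑ i ∈ T, y i l ≤ (#T : ℝ) - ∑ l ∈ O'ᶜ, (f l : ℝ) := by
      intro T f hf O'
      have h1 := sum_le_sum fun l (_ : l ∈ O'ᶜ) => hf l
      have h2 : ∑ l, ∑ i ∈ T, y i l ≤ #T := by
        rw [sum_comm]
        simpa using sum_le_sum fun i (_ : i ∈ T) => y1 i
      rw [← sum_add_sum_compl O'] at h2
      linarith
    have hcol : ∀ l, ∑ i ∈ Im, y i l + ∑ i ∈ IM, y i l ≤ q l := fun l => by
      rw [sum_add_sum_of_partition hcover hdisj]; exact y2 l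
    refine ⟨x0, fun i => (sum_le_sum fun l _ => hxy i l).trans (y1 i),
      fun l => (sum_le_sum fun i _ => hxy i l).trans (y2 l), fun O' hO' => ?_, fun O' hO' => ?_⟩
    · refine (sum_le_sum fun i _ => sum_le_sum fun l _ => hxy i l).trans ?_
      rw [sum_comm]
      exact sum_le_modifiedQuota hm1 hmrec (fun l => (y3 l).2)
        (fun l => hcap_le (hcol l) (y4 l).1) (hN Im qml fun l => (y3 l).1) hO'
    · refine (sum_le_sum fun i _ => sum_le_sum fun l _ => hxy i l).trans ?_
      rw [sum_comm]
      exact sum_le_modifiedQuota hM1 hMrec (fun l => (y4 l).2)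
        (fun l => hcap_le ((add_comm _ _).trans_le (hcol l)) (y3 l).1)
        (hN IM qMl fun l => (y4 l).1) hO'
  · rintro ⟨x0, x1, x2, x3, x4⟩
    have h3 : ∀ O' : Finset O, O'.Nonempty → ∑ l ∈ O', ∑ i ∈ Im, x i l ≤ q'm O' :=
      fun O' hO' => by rw [sum_comm]; exact x3 O' hO'
    have h4 : ∀ O' : Finset O, O'.Nonempty → ∑ l ∈ O', ∑ i ∈ IM, x i l ≤ q'M O' :=
      fun O' hO' => by rw [sum_comm]; exact x4 O' hO'
    obtain ⟨y, hxy, y1, hy⟩ := exists_ge_sum_eq x1 (fun l => le_max_left _ _)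
      (sum_max_le_of_le_modifiedQuota hm1 hmrec hNm h3)
    obtain ⟨z, hxz, z1, hz⟩ := exists_ge_sum_eq x1 (fun l => le_max_left _ _)
      (sum_max_le_of_le_modifiedQuota hM1 hMrec hNM h4)
    have hbound : ∀ {u : ℝ} {b k : ℕ} {l : O} {Q e : ℤ},
        Q = min (min (b : ℤ) ((q l : ℤ) - k)) e → u ≤ Q → u ≤ b ∧ u + k ≤ q l := by
      rintro u b k l Q e rfl h
      push_cast at h
      have h' := h.trans (min_le_left _ _)
      exact ⟨h'.trans (min_le_left _ _), by linarith [h'.trans (min_le_right _ _)]⟩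
    have hmb := fun l => hbound (hm1 l) (by simpa using h3 {l} (singleton_nonempty l))
    have hMb := fun l => hbound (hM1 l) (by simpa using h4 {l} (singleton_nonempty l))
    let w : I → O → ℝ := fun i => if i ∈ Im then y i else z i
    have hxw : ∀ i l, x i l ≤ w i l := fun i l => by
      by_cases hi : i ∈ Im
      · simpa [w, hi] using hxy i l
      · simpa [w, hi] using hxz i l
    have hwm : ∀ l, ∑ i ∈ Im, w i l = max (∑ i ∈ Im, x i l) (qml l : ℝ) := fun l => by
      rw [← hy l]; exact sum_congr rfl fun i hi => by simp [w, hi]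
    have hwM : ∀ l, ∑ i ∈ IM, w i l = max (∑ i ∈ IM, x i l) (qMl l : ℝ) := fun l => by
      rw [← hz l]
      exact sum_congr rfl fun i hi => by simp [w, disjoint_right.mp hdisj hi]
    refine ⟨x0, w, ⟨fun i l => (x0 i l).trans (hxw i l), fun i => ?_, fun l => ?_,
      fun l => ?_, fun l => ?_⟩, hxw⟩
    · by_cases hi : i ∈ Im
      · simpa [w, hi] using y1 i
      · simpa [w, hi] using z1 i
    · have hx2 := x2 l
      have hq2 : (qml l : ℝ) + qMl l ≤ q l := by exact_mod_cast hsum l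
      have hb1 := (hmb l).2
      have hb2 := (hMb l).2
      rw [← sum_add_sum_of_partition hcover hdisj] at hx2 ⊢
      rw [hwm, hwM, max_add, add_max, add_max]
      exact max_le (max_le hx2 hb1) (max_le (by linarith) hq2)
    · rw [hwm]
      exact ⟨le_max_right _ _, max_le (hmb l).1 (by exact_mod_cast hm l)⟩
    · rw [hwM]
      exact ⟨le_max_right _ _, max_le (hMb l).1 (by exact_mod_cast hM l)⟩
end
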